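/- Quantitative Liouville-type estimate in non-divergence form (Proposition 6.2). Let s ∈ (0,1), β ∈ (0,2s) with β ≠ 1, δ > 0, and 0 < λ ≤ Λ. Let (K_x)_{x∈ℝⁿ} be a family of symmetric Lévy measures, uniformly elliptic of order 2s with constants λ, Λ, satisfying for some η ≤ δ: for all x, x' ∈ ℝⁿ, all ρ > 0, and every φ : ℝⁿ → ℝ with [φ]_{C^β(ℝⁿ)} ≤ 1 and φ(0) = 0, |∫_{B_{2ρ}∖B_ρ} φ d(K_x − K_{x'})| ≤ η ρ^{β−2s}. Let u ∈ C^{2s+ε'}(ℝⁿ) for some ε' > 0 with u ∈ L^∞(ℝⁿ) and [u]_{C^β(ℝⁿ)} ≤ 1, and let f ∈ L^∞_loc(ℝⁿ) with ‖f‖_{L^∞(B_{1/δ})} ≤ δ, be such that L(u,x) = f(x) for every x ∈ B_{1/δ}. Then for every ε₀ > 0 there exists δ₀ > 0, depending only on ε₀, β, n, s, λ, Λ, such that if δ < δ₀ then ‖u − ℓ‖_{C^{⌊β⌋}(B₁)} ≤ ε₀, where ℓ is the ⌊β⌋-th order Taylor expansion of u at 0 (that is, ℓ = u(0) if β < 1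 and ℓ(x) = u(0) + ∇u(0)·x if β > 1), and ‖·‖_{C⁰} denotes the supremum norm while ‖v‖_{C¹(B₁)} = ‖v‖_{L^∞(B₁)} + ‖∇v‖_{L^∞(B₁)}. -/

import Mathlib

open MeasureTheory Metric Set
open scoped ENNReal Topology RealInnerProductSpace

noncomputable section

abbrev Euc (n : ℕ) := EuclideanSpace ℝ (Fin n)

variable {n : ℕ}

def hDeg (σ : ℝ) : ℕ := ⌈σ⌉₊ - 1

def hSemiOn (σ : ℝ) (Ω A : Set (Euc n)) (u : Euc n → ℝ) : ℝ≥0∞ :=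
  ⨆ (x : A) (y : A),
    ENNReal.ofReal
      (‖iteratedFDerivWithin ℝ (hDeg σ) u Ω ↑x - iteratedFDerivWithin ℝ (hDeg σ) u Ω ↑y‖ /
        ‖(x : Euc n) - (y : Euc n)‖ ^ (σ - (hDeg σ : ℝ)))

def hSemi (σ : ℝ) (Ω : Set (Euc n)) (u : Euc n → ℝ) : ℝ≥0∞ := hSemiOn σ Ω Ω u

def hNormOn (σ : ℝ) (Ω A : Set (Euc n)) (u : Euc n → ℝ) : ℝ≥0∞ :=
  (∑ j ∈ Finset.range (hDeg σ + 1), ⨆ x : A, ENNReal.ofReal ‖iteratedFDerivWithin ℝ j u Ω ↑x‖) +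
    hSemiOn σ Ω A u

def hNorm (σ : ℝ) (Ω : Set (Euc n)) (u : Euc n → ℝ) : ℝ≥0∞ := hNormOn σ Ω Ω u

def HolderMem (σ : ℝ) (Ω : Set (Euc n)) (u : Euc n → ℝ) : Prop :=
  ContDiffOn ℝ (hDeg σ) u Ω ∧ hNorm σ Ω u ≠ ⊤

def HolderMemLoc (σ : ℝ) (Ω : Set (Euc n)) (u : Euc n → ℝ) : Prop :=
  ContDiffOn ℝ (hDeg σ) u Ω ∧
    ∀ A : Set (Euc n), IsCompact A → A ⊆ Ω → hNormOn σ Ω A u ≠ ⊤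

def supNorm (Ω : Set (Euc n)) (u : Euc n → ℝ) : ℝ≥0∞ :=
  ⨆ x : Ω, ENNReal.ofReal |u ↑x|

def supNormW (τ : ℝ) (u : Euc n → ℝ) : ℝ≥0∞ :=
  ⨆ x : Euc n, ENNReal.ofReal (|u x| / (1 + ‖x‖ ^ τ))

def IsLevyMeasure (K : Measure (Euc n)) : Prop :=
  K {0} = 0 ∧ (∫⁻ y, ENNReal.ofReal (min 1 (‖y‖ ^ 2)) ∂K) ≠ ⊤ ∧
    Measure.map (fun y => -y) K = K

def UnifElliptic (s lam Lam : ℝ) (K : Measure (Euc n)) : Prop :=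
  (∀ r : ℝ, 0 < r →
    ENNReal.ofReal (r ^ (2 * s)) * K (ball 0 (2 * r) \ ball 0 r) ≤ ENNReal.ofReal Lam) ∧
  (∀ r : ℝ, 0 < r → ∀ e : Euc n, ‖e‖ = 1 →
    ENNReal.ofReal lam ≤
      ENNReal.ofReal (r ^ (2 * s - 2)) * ∫⁻ y in ball 0 r, ENNReal.ofReal (⟪e, y⟫ ^ 2) ∂K)

def Lop (K : Euc n → Measure (Euc n)) (u : Euc n → ℝ) (x : Euc n) : ℝ :=
  (1 / 2) * ∫ y, (2 * u x - u (x + y) - u (x - y)) ∂(K x)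

def LopTI (K : Measure (Euc n)) (u : Euc n → ℝ) (x : Euc n) : ℝ :=
  (1 / 2) * ∫ y, (2 * u x - u (x + y) - u (x - y)) ∂K

def SolvesPtwise (K : Euc n → Measure (Euc n)) (u f : Euc n → ℝ) (Ω : Set (Euc n)) : Prop :=
  ∀ x ∈ Ω, Integrable (fun y => 2 * u x - u (x + y) - u (x - y)) (K x) ∧ Lop K u x = f x

def tvDiff (μ ν : Measure (Euc n)) (A : Set (Euc n)) : ℝ≥0∞ :=
  (μ.restrict A - ν.restrict A) Set.univ + (ν.restrict A - μ.restrict A) Set.univ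

def kernelHolder (s θ : ℝ) (K : Measure (Euc n)) : ℝ≥0∞ :=
  ⨆ (ρ : ℝ) (_ : 0 < ρ) (x : Euc n) (x' : Euc n)
      (_ : x ∈ ball 0 (ρ / 2)) (_ : x' ∈ ball 0 (ρ / 2)) (_ : x ≠ x'),
    ENNReal.ofReal (ρ ^ (2 * s + θ) / ‖x - x'‖ ^ θ) *
      tvDiff (Measure.map (fun y => x - y) K) (Measure.map (fun y => x' - y) K)
        (ball 0 (2 * ρ) \ ball 0 ρ)

def KantCond (s γ : ℝ) (μ ν : Measure (Euc n)) (c : ℝ) : Prop :=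
  ∀ ρ : ℝ, 0 < ρ → ∀ φ : Euc n → ℝ, ContDiff ℝ (hDeg γ) φ →
    hSemi γ Set.univ φ ≤ 1 → φ 0 = 0 →
    |(∫ y in ball 0 (2 * ρ) \ ball 0 ρ, φ y ∂μ) -
        ∫ y in ball 0 (2 * ρ) \ ball 0 ρ, φ y ∂ν| ≤ c * ρ ^ (γ - 2 * s)


def gradSupOn (Ω : Set (Euc n)) (u : Euc n → ℝ) : ℝ≥0∞ :=
  ⨆ x : Ω, ENNReal.ofReal ‖fderiv ℝ u (x : Euc n)‖

def c1Norm (Ω : Set (Euc n)) (u : Euc n → ℝ) : ℝ≥0∞ :=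
  supNorm Ω u + gradSupOn Ω u

/-- The centred second difference of `a` at `x` in direction `y`. -/
def secondDiff (a : Euc n → ℝ) (x y : Euc n) : ℝ := a (x + y) + a (x - y) - 2 * a x

/-- Functions of regularity `C^β` whose global `C^β` seminorm is at most one. -/
def HolderUnit (β : ℝ) (a : Euc n → ℝ) : Prop :=
  ContDiff ℝ (hDeg β) a ∧ hSemi β Set.univ a ≤ 1

/-- Functions whose Taylor polynomial of order `⌊β⌋` at the origin vanishes. -/
def TaylorZero (β : ℝ) (a : Euc n → ℝ) : Prop :=
  a 0 = 0 ∧ (1 < β → fderiv ℝ a 0 = 0)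

lemma hDeg_of_lt_one {β : ℝ} (h0 : 0 < β) (h1 : β < 1) : hDeg β = 0 := by
  have : ⌈β⌉₊ = 1 := by
    rw [Nat.ceil_eq_iff one_ne_zero]
    constructor <;> norm_num <;> linarith
  simp [hDeg, this]

lemma hDeg_of_one_lt {β : ℝ} (h1 : 1 < β) (h2 : β < 2) : hDeg β = 1 := by
  have : ⌈β⌉₊ = 2 := by
    rw [Nat.ceil_eq_iff two_ne_zero]
    constructor <;> norm_num <;> linarith
  simp [hDeg, this]

lemma hDeg_mono {β γ : ℝ} (h : β ≤ γ) : hDeg β ≤ hDeg γ :=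
  Nat.sub_le_sub_right (Nat.ceil_mono h) 1

lemma hSemi_univ_le_one_iff {β : ℝ} {d : ℕ} (hd : hDeg β = d) (hβ : (d : ℝ) < β)
    (a : Euc n → ℝ) :
    hSemi β Set.univ a ≤ 1 ↔ ∀ x y : Euc n,
      dist (iteratedFDerivWithin ℝ d a univ x) (iteratedFDerivWithin ℝ d a univ y) ≤
        ‖x - y‖ ^ (β - d) := by
  subst hd
  simp only [hSemi, hSemiOn, iSup_le_iff, Subtype.forall, mem_univ, forall_true_left,
    ENNReal.ofReal_le_one, dist_eq_norm]
  refine forall_congr' fun x => forall_congr' fun y => ?_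
  rcases eq_or_ne x y with rfl | hxy
  · simp [Real.zero_rpow (sub_pos.2 hβ).ne']
  · rw [div_le_one (Real.rpow_pos_of_pos (norm_pos_iff.2 (sub_ne_zero.2 hxy)) _)]

lemma holderUnit_iff_of_lt_one {β : ℝ} (h0 : 0 < β) (h1 : β < 1) (a : Euc n → ℝ) :
    HolderUnit β a ↔ ∀ x y : Euc n, |a x - a y| ≤ ‖x - y‖ ^ β := by
  have hd := hDeg_of_lt_one h0 h1
  have key : hSemi β Set.univ a ≤ 1 ↔ ∀ x y : Euc n, |a x - a y| ≤ ‖x - y‖ ^ β := by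
    rw [hSemi_univ_le_one_iff hd (by simpa using h0)]
    simp only [iteratedFDerivWithin_zero_eq_comp, Function.comp_apply, LinearIsometryEquiv.dist_map,
      Real.dist_eq, Nat.cast_zero, sub_zero]
  refine ⟨fun h => key.1 h.2, fun h => ⟨?_, key.2 h⟩⟩
  rw [hd]
  refine contDiff_zero.2 (continuous_iff_continuousAt.2 fun x => ?_)
  rw [ContinuousAt, tendsto_iff_dist_tendsto_zero]
  have hlim : Filter.Tendsto (fun y : Euc n => ‖y - x‖ ^ β) (𝓝 x) (𝓝 0) := by
    have : Continuous fun y : Euc n => ‖y - x‖ ^ β :=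
      (continuous_id.sub continuous_const).norm.rpow_const fun _ => Or.inr h0.le
    simpa [Real.zero_rpow h0.ne'] using this.tendsto x
  exact squeeze_zero (fun _ => dist_nonneg) (fun y => by simpa [Real.dist_eq] using h y x) hlim

lemma holderUnit_iff_of_one_lt {β : ℝ} (h1 : 1 < β) (h2 : β < 2) (a : Euc n → ℝ) :
    HolderUnit β a ↔ ContDiff ℝ 1 a ∧
      ∀ x y : Euc n, ‖fderiv ℝ a x - fderiv ℝ a y‖ ≤ ‖x - y‖ ^ (β - 1) := by
  have hd := hDeg_of_one_lt h1 h2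
  rw [HolderUnit, hSemi_univ_le_one_iff hd (by simpa using h1), hd]
  refine and_congr (by simp) (forall_congr' fun x => forall_congr' fun y => ?_)
  rw [dist_iteratedFDerivWithin_one _ _ uniqueDiffWithinAt_univ uniqueDiffWithinAt_univ,
    fderivWithin_univ, dist_eq_norm, Nat.cast_one]

lemma HolderUnit.continuous {β : ℝ} {a : Euc n → ℝ} (ha : HolderUnit β a) : Continuous a :=
  ha.1.continuous

lemma HolderUnit.comp_add_sub {β : ℝ} (hβ : β ∈ Ioo 0 2) (hβ1 : β ≠ 1) {a : Euc n → ℝ}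
    (ha : HolderUnit β a) (σ : ℝ) (hσ : |σ| ≤ 1) (x₀ : Euc n) (c : ℝ) (l : Euc n →L[ℝ] ℝ)
    (hl : β < 1 → l = 0) :
    HolderUnit β fun x => σ * a (x + x₀) - (c + l x) := by
  rcases hβ1.lt_or_gt with h1 | h1
  · rw [holderUnit_iff_of_lt_one hβ.1 h1] at ha ⊢
    intro x y
    have h := ha (x + x₀) (y + x₀)
    simp only [hl h1, add_sub_add_right_eq_sub, zero_apply] at h ⊢
    calc _ = |σ| * |a (x + x₀) - a (y + x₀)| := by rw [← abs_mul]; ring_nf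
      _ ≤ 1 * ‖x - y‖ ^ β := by gcongr
      _ = _ := one_mul _
  · rw [holderUnit_iff_of_one_lt h1 hβ.2] at ha ⊢
    obtain ⟨hd, ha⟩ := ha
    have hder : ∀ x, HasFDerivAt (fun x => σ * a (x + x₀) - (c + l x))
        (σ • fderiv ℝ a (x + x₀) - l) x := fun x => by
      have h0 := (hd.differentiable one_ne_zero (x + x₀)).hasFDerivAt.comp x
        ((hasFDerivAt_id x).add_const x₀)
      exact (h0.const_mul σ).sub (l.hasFDerivAt.const_add c)
    refine ⟨by fun_prop, fun x y => ?_⟩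
    rw [(hder x).fderiv, (hder y).fderiv, sub_sub_sub_cancel_right, ← smul_sub, norm_smul]
    have h := ha (x + x₀) (y + x₀)
    rw [add_sub_add_right_eq_sub] at h
    calc _ ≤ 1 * ‖x - y‖ ^ (β - 1) := by gcongr; exact hσ
      _ = _ := one_mul _

lemma secondDiff_zero (a : Euc n → ℝ) (x : Euc n) : secondDiff a x 0 = 0 := by
  simp [secondDiff]; ring

lemma continuous_secondDiff {a : Euc n → ℝ} (ha : Continuous a) (x : Euc n) :
    Continuous (secondDiff a x) := by
  unfold secondDiff; fun_prop

lemma continuous_secondDiff_left {a : Euc n → ℝ} (ha : Continuous a) (y : Euc n) :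
    Continuous fun x => secondDiff a x y := by
  unfold secondDiff; fun_prop

lemma secondDiff_comp_add_sub (a : Euc n → ℝ) (σ : ℝ) (x₀ : Euc n) (c : ℝ) (l : Euc n →L[ℝ] ℝ)
    (x y : Euc n) :
    secondDiff (fun x => σ * a (x + x₀) - (c + l x)) x y = σ * secondDiff a (x + x₀) y := by
  simp only [secondDiff, map_add, map_sub, add_right_comm x y x₀, sub_add_eq_add_sub]
  ring

lemma HolderUnit.secondDiff_div_two {β : ℝ} (hβ : β ∈ Ioo 0 2) (hβ1 : β ≠ 1) {a : Euc n → ℝ}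
    (ha : HolderUnit β a) (x : Euc n) : HolderUnit β fun y => secondDiff a x y / 2 := by
  unfold secondDiff
  rcases hβ1.lt_or_gt with h1 | h1
  · rw [holderUnit_iff_of_lt_one hβ.1 h1] at ha ⊢
    intro y y'
    have h := ha (x + y) (x + y')
    have h' := ha (x - y) (x - y')
    rw [add_sub_add_left_eq_sub] at h
    rw [sub_sub_sub_cancel_left, norm_sub_rev] at h'
    rw [abs_le] at *
    constructor <;> linarith [h.1, h'.1, h.2, h'.2]
  · rw [holderUnit_iff_of_one_lt h1 hβ.2] at ha ⊢
    obtain ⟨hd, ha⟩ := ha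
    have hder : ∀ y, HasFDerivAt (fun y => (a (x + y) + a (x - y) - 2 * a x) / 2)
        ((2 : ℝ)⁻¹ • (fderiv ℝ a (x + y) + -fderiv ℝ a (x - y))) y := fun y => by
      have h0 := (hd.differentiable one_ne_zero (x + y)).hasFDerivAt.comp y
        ((hasFDerivAt_id y).const_add x)
      have h1 := (hd.differentiable one_ne_zero (x - y)).hasFDerivAt.comp y
        ((hasFDerivAt_id y).const_sub x)
      have h2 := ((h0.add h1).sub_const (2 * a x)).const_mul (2 : ℝ)⁻¹
      refine (h2.congr_fderiv ?_).congr_of_eventuallyEq (.of_forall fun z => ?_)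
      · simp
      · simp [div_eq_inv_mul]
    refine ⟨by fun_prop, fun y y' => ?_⟩
    rw [(hder y).fderiv, (hder y').fderiv, ← smul_sub, norm_smul]
    have h := ha (x + y) (x + y')
    have h' := ha (x - y) (x - y')
    rw [add_sub_add_left_eq_sub] at h
    rw [sub_sub_sub_cancel_left, norm_sub_rev, norm_sub_rev y'] at h'
    have e : fderiv ℝ a (x + y) + -fderiv ℝ a (x - y) -
        (fderiv ℝ a (x + y') + -fderiv ℝ a (x - y')) =
        (fderiv ℝ a (x + y) - fderiv ℝ a (x + y')) +
          (fderiv ℝ a (x - y') - fderiv ℝ a (x - y)) := by abel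
    rw [e]
    have := norm_add_le (fderiv ℝ a (x + y) - fderiv ℝ a (x + y'))
          (fderiv ℝ a (x - y') - fderiv ℝ a (x - y))
    norm_num
    linarith

lemma HolderUnit.abs_sub_le {β : ℝ} (hβ : β ∈ Ioo 0 2) (hβ1 : β ≠ 1) {a : Euc n → ℝ}
    (ha : HolderUnit β a) (ht : TaylorZero β a) {R : ℝ} {x y : Euc n}
    (hx : ‖x‖ ≤ R) (hy : ‖y‖ ≤ R) :
    |a x - a y| ≤ (1 + R) * (‖x - y‖ + ‖x - y‖ ^ β) := by
  have hR : 0 ≤ R := (norm_nonneg x).trans hx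
  have hn : 0 ≤ ‖x - y‖ := norm_nonneg _
  have hp : 0 ≤ ‖x - y‖ ^ β := Real.rpow_nonneg hn _
  rcases hβ1.lt_or_gt with h1 | h1
  · have h := (holderUnit_iff_of_lt_one hβ.1 h1 a).1 ha x y
    nlinarith
  · obtain ⟨hd, ha⟩ := (holderUnit_iff_of_one_lt h1 hβ.2 a).1 ha
    have hb : ∀ z ∈ closedBall (0 : Euc n) R, ‖fderiv ℝ a z‖ ≤ 1 + R := fun z hz => by
      have h := ha z 0
      rw [ht.2 h1, sub_zero, sub_zero] at h
      rw [mem_closedBall_zero_iff] at hz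
      calc _ ≤ ‖z‖ ^ (β - 1) := h
        _ ≤ (1 + R) ^ (β - 1) := by
          gcongr
          linarith
        _ ≤ (1 + R) ^ (1 : ℝ) :=
          Real.rpow_le_rpow_of_exponent_le (by linarith) (by linarith [hβ.2])
        _ = _ := Real.rpow_one _
    have := (convex_closedBall (0 : Euc n) R).norm_image_sub_le_of_norm_fderiv_le
      (fun z _ => hd.differentiable one_ne_zero z) hb
      (mem_closedBall_zero_iff.2 hy) (mem_closedBall_zero_iff.2 hx)
    rw [Real.norm_eq_abs] at this
    nlinarith

lemma HolderUnit.abs_le_rpow {β : ℝ} (hβ : β ∈ Ioo 0 2) (hβ1 : β ≠ 1) {a : Euc n → ℝ}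
    (ha : HolderUnit β a) (ht : TaylorZero β a) (x : Euc n) : |a x| ≤ ‖x‖ ^ β := by
  rcases hβ1.lt_or_gt with h1 | h1
  · simpa [ht.1] using (holderUnit_iff_of_lt_one hβ.1 h1 a).1 ha x 0
  · obtain ⟨hd, ha⟩ := (holderUnit_iff_of_one_lt h1 hβ.2 a).1 ha
    have hb : ∀ z ∈ closedBall (0 : Euc n) ‖x‖, ‖fderiv ℝ a z‖ ≤ ‖x‖ ^ (β - 1) := fun z hz => by
      have h := ha z 0
      rw [ht.2 h1, sub_zero, sub_zero] at h
      rw [mem_closedBall_zero_iff] at hz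
      exact h.trans (by gcongr)
    have := (convex_closedBall (0 : Euc n) ‖x‖).norm_image_sub_le_of_norm_fderiv_le
      (fun z _ => hd.differentiable one_ne_zero z) hb
      (mem_closedBall_self (norm_nonneg x)) (mem_closedBall_zero_iff.2 le_rfl)
    rw [ht.1, sub_zero, sub_zero, Real.norm_eq_abs] at this
    refine this.trans_eq ?_
    rcases eq_or_ne x 0 with rfl | hx
    · simp [Real.zero_rpow hβ.1.ne']
    · rw [← Real.rpow_add_one (norm_ne_zero_iff.2 hx), sub_add_cancel]

lemma HolderUnit.abs_secondDiff_le {β : ℝ} (hβ : β ∈ Ioo 0 2) (hβ1 : β ≠ 1) {a : Euc n → ℝ}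
    (ha : HolderUnit β a) (x y : Euc n) : |secondDiff a x y| ≤ 2 * ‖y‖ ^ β := by
  have h := (ha.secondDiff_div_two hβ hβ1 x).abs_le_rpow hβ hβ1 ⟨by simp [secondDiff_zero],
    fun h1 => ?_⟩ y
  · rw [abs_div, abs_two] at h
    linarith
  · have hd : DifferentiableAt ℝ (fun y => secondDiff a x y / 2) 0 :=
      (((holderUnit_iff_of_one_lt h1 hβ.2 _).1
        (ha.secondDiff_div_two hβ hβ1 x)).1.differentiable one_ne_zero) 0
    have heven : (fun y => secondDiff a x y / 2) = fun y => secondDiff a x (-y) / 2 := by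
      funext y; simp only [secondDiff, sub_neg_eq_add, ← sub_eq_add_neg]; ring
    have hneg := hd.hasFDerivAt
    rw [← neg_zero] at hneg
    have hcomp := hneg.comp (0 : Euc n) (hasFDerivAt_id (𝕜 := ℝ) (0 : Euc n)).neg
    have heq := hd.hasFDerivAt.unique (hcomp.congr_of_eventuallyEq
      (.of_forall fun y => congrFun heven y))
    ext v
    have hv := congrArg (fun l : Euc n →L[ℝ] ℝ => l v) heq
    simpa [self_eq_neg] using hv

lemma HolderUnit.norm_fderiv_le {β : ℝ} (h1 : 1 < β) (h2 : β < 2) {a : Euc n → ℝ}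
    (ha : HolderUnit β a) {ε t : ℝ} (ht : 0 < t) (ht1 : t ≤ 1)
    (hε : ∀ x ∈ ball (0 : Euc n) 2, |a x| ≤ ε) {x : Euc n} (hx : x ∈ ball (0 : Euc n) 1) :
    ‖fderiv ℝ a x‖ ≤ 2 * ε / t + t ^ (β - 1) := by
  obtain ⟨hd, hf⟩ := (holderUnit_iff_of_one_lt h1 h2 a).1 ha
  rw [mem_ball_zero_iff] at hx
  have hε0 : 0 ≤ ε := (abs_nonneg _).trans (hε 0 (by simp))
  have hpos : 0 ≤ 2 * ε / t + t ^ (β - 1) := by positivity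
  refine ContinuousLinearMap.opNorm_le_of_unit_norm hpos fun v hv => ?_
  have hb : ∀ z ∈ closedBall x t, ‖fderiv ℝ a z - fderiv ℝ a x‖ ≤ t ^ (β - 1) := fun z hz =>
    (hf z x).trans (by
      rw [mem_closedBall, dist_eq_norm] at hz
      gcongr)
  have htv : ‖t • v‖ = t := by rw [norm_smul, hv, Real.norm_of_nonneg ht.le, mul_one]
  have key := (convex_closedBall x t).norm_image_sub_le_of_norm_fderiv_le'
    (fun z _ => hd.differentiable one_ne_zero z) hb (mem_closedBall_self ht.le)
    (y := x + t • v) (by simp [htv])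
  rw [add_sub_cancel_left, htv, map_smul, smul_eq_mul, Real.norm_eq_abs] at key
  have hA := hε x (by rw [mem_ball_zero_iff]; linarith)
  have hB := hε (x + t • v) (by
    rw [mem_ball_zero_iff]
    linarith [norm_add_le x (t • v)])
  rw [Real.norm_eq_abs, ← mul_le_mul_iff_right₀ ht]
  have e : t * (2 * ε / t + t ^ (β - 1)) = 2 * ε + t ^ (β - 1) * t := by field_simp
  rw [e, ← abs_of_pos ht, ← abs_mul, abs_of_pos ht]
  rw [abs_le] at *
  constructor <;> linarith [hA.1, hA.2, hB.1, hB.2, key.1, key.2]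

lemma UnifElliptic.ring_le {s lam Lam : ℝ} {K : Measure (Euc n)} (hK : UnifElliptic s lam Lam K)
    {r : ℝ} (hr : 0 < r) :
    K (ball 0 (2 * r) \ ball 0 r) ≤ ENNReal.ofReal (Lam * r ^ (-(2 * s))) := by
  have hp : 0 < r ^ (2 * s) := Real.rpow_pos_of_pos hr _
  have h := hK.1 r hr
  rw [Real.rpow_neg hr.le, ← div_eq_mul_inv, ENNReal.ofReal_div_of_pos hp,
    ENNReal.le_div_iff_mul_le (.inl (by simpa using hp)) (.inl ENNReal.ofReal_ne_top), mul_comm]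
  exact h

/-- The constant in the power moment bounds for uniformly elliptic kernels. -/
def momentConst (s p t Lam : ℝ) : ℝ := 2 ^ p * Lam * (1 - t ^ (p - 2 * s))⁻¹

lemma momentConst_nonneg {s p t Lam : ℝ} (hL : 0 ≤ Lam) (ht1 : t ^ (p - 2 * s) < 1) :
    0 ≤ momentConst s p t Lam := by
  have : 0 < 1 - t ^ (p - 2 * s) := sub_pos.2 ht1
  unfold momentConst
  positivity

lemma UnifElliptic.lintegral_rpow_le {s lam Lam : ℝ} {K : Measure (Euc n)}
    (hK : UnifElliptic s lam Lam K) (hL : 0 ≤ Lam) {p t ρ : ℝ} (hp : 0 < p) (ht : 0 < t)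
    (ht1 : t ^ (p - 2 * s) < 1) (hρ : 0 < ρ) {S : Set (Euc n)}
    (hS : S ⊆ {0} ∪ ⋃ j : ℕ, ball 0 (2 * (ρ * t ^ j)) \ ball 0 (ρ * t ^ j)) :
    ∫⁻ y in S, ENNReal.ofReal (‖y‖ ^ p) ∂K ≤
      ENNReal.ofReal (momentConst s p t Lam * ρ ^ (p - 2 * s)) := by
  have hq : 0 < t ^ (p - 2 * s) := Real.rpow_pos_of_pos ht _
  have hzero : ∫⁻ y in ({0} : Set (Euc n)), ENNReal.ofReal (‖y‖ ^ p) ∂K = 0 := by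
    rw [setLIntegral_congr_fun (g := fun _ => 0) (measurableSet_singleton 0)]
    · simp
    · rintro y rfl
      simp [Real.zero_rpow hp.ne']
  have hring : ∀ j : ℕ, ∫⁻ y in ball 0 (2 * (ρ * t ^ j)) \ ball 0 (ρ * t ^ j),
      ENNReal.ofReal (‖y‖ ^ p) ∂K ≤
        ENNReal.ofReal (2 ^ p * Lam * ρ ^ (p - 2 * s) * (t ^ (p - 2 * s)) ^ j) := fun j => by
    have hρj : 0 < ρ * t ^ j := by positivity
    calc _ ≤ ∫⁻ y in ball 0 (2 * (ρ * t ^ j)) \ ball 0 (ρ * t ^ j),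
          ENNReal.ofReal ((2 * (ρ * t ^ j)) ^ p) ∂K := by
          refine setLIntegral_mono' (measurableSet_ball.diff measurableSet_ball) fun y hy => ?_
          have := (mem_ball_zero_iff.1 hy.1).le
          gcongr
      _ = ENNReal.ofReal ((2 * (ρ * t ^ j)) ^ p) *
          K (ball 0 (2 * (ρ * t ^ j)) \ ball 0 (ρ * t ^ j)) := by simp
      _ ≤ ENNReal.ofReal ((2 * (ρ * t ^ j)) ^ p) *
          ENNReal.ofReal (Lam * (ρ * t ^ j) ^ (-(2 * s))) := by
          gcongr; exact hK.ring_le hρj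
      _ = _ := by
          rw [← ENNReal.ofReal_mul (by positivity)]
          congr 1
          have e : (t ^ (p - 2 * s)) ^ j = (t ^ j) ^ (p - 2 * s) := by
            rw [← Real.rpow_natCast, ← Real.rpow_natCast, ← Real.rpow_mul ht.le,
              ← Real.rpow_mul ht.le, mul_comm]
          rw [e, Real.mul_rpow two_pos.le hρj.le, sub_eq_add_neg p, mul_assoc (2 ^ p * Lam),
            ← Real.mul_rpow hρ.le (by positivity), Real.rpow_add hρj]
          ring
  calc _ ≤ ∫⁻ y in {0} ∪ ⋃ j : ℕ, ball 0 (2 * (ρ * t ^ j)) \ ball 0 (ρ * t ^ j),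
        ENNReal.ofReal (‖y‖ ^ p) ∂K := lintegral_mono_set hS
    _ ≤ 0 + ∑' j : ℕ, ENNReal.ofReal (2 ^ p * Lam * ρ ^ (p - 2 * s) * (t ^ (p - 2 * s)) ^ j) := by
        refine (lintegral_union_le _ _ _).trans ?_
        rw [hzero]
        gcongr
        exact (lintegral_iUnion_le _ _).trans (ENNReal.tsum_le_tsum hring)
    _ = _ := by
        rw [zero_add, ← ENNReal.ofReal_tsum_of_nonneg (fun j => by positivity)
          ((summable_geometric_of_lt_one hq.le ht1).mul_left _), tsum_mul_left,
          tsum_geometric_of_lt_one hq.le ht1, momentConst]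
        congr 1
        ring

lemma ball_subset_iUnion_ring {ρ : ℝ} (hρ : 0 < ρ) :
    ball (0 : Euc n) ρ ⊆ {0} ∪ ⋃ j : ℕ,
      ball 0 (2 * (ρ / 2 * (1 / 2 : ℝ) ^ j)) \ ball 0 (ρ / 2 * (1 / 2 : ℝ) ^ j) := by
  classical
  intro y hy
  rcases eq_or_ne y 0 with rfl | h0
  · simp
  right
  have hy0 : 0 < ‖y‖ := norm_pos_iff.2 h0
  have hex : ∃ j : ℕ, ρ / 2 * (1 / 2 : ℝ) ^ j ≤ ‖y‖ := by
    obtain ⟨j, hj⟩ := exists_pow_lt_of_lt_one (show 0 < ‖y‖ / (ρ / 2) by positivity)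
      (show (1 / 2 : ℝ) < 1 by norm_num)
    rw [lt_div_iff₀ (by positivity)] at hj
    exact ⟨j, by linarith⟩
  refine mem_iUnion.2 ⟨Nat.find hex, ?_, ?_⟩
  · rw [mem_ball_zero_iff]
    rcases hj : Nat.find hex with _ | k
    · rw [mem_ball_zero_iff] at hy
      linarith
    · have := Nat.find_min hex (m := k) (by omega)
      rw [not_le] at this
      rw [pow_succ]
      linarith
  · rw [mem_ball_zero_iff, not_lt]
    exact Nat.find_spec hex

lemma compl_ball_eq_iUnion_ring {ρ : ℝ} (hρ : 0 < ρ) :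
    (ball (0 : Euc n) ρ)ᶜ = ⋃ j : ℕ, ball 0 (2 * (ρ * 2 ^ j)) \ ball 0 (ρ * 2 ^ j) := by
  ext y
  simp only [mem_compl_iff, mem_ball_zero_iff, not_lt, mem_iUnion, mem_sdiff]
  constructor
  · intro hy
    obtain ⟨j, h1, h2⟩ := exists_nat_pow_near ((one_le_div hρ).2 hy) one_lt_two
    rw [le_div_iff₀ hρ] at h1
    rw [div_lt_iff₀ hρ, pow_succ] at h2
    exact ⟨j, by linarith, by linarith⟩
  · rintro ⟨j, -, h2⟩
    have : (1 : ℝ) ≤ 2 ^ j := one_le_pow₀ one_le_two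
    nlinarith

lemma half_rpow_lt_one {s : ℝ} (hs : s < 1) : (1 / 2 : ℝ) ^ (2 - 2 * s) < 1 :=
  Real.rpow_lt_one (by norm_num) (by norm_num) (by linarith)

lemma two_rpow_lt_one {s β : ℝ} (hβ : β < 2 * s) : (2 : ℝ) ^ (β - 2 * s) < 1 :=
  Real.rpow_lt_one_of_one_lt_of_neg one_lt_two (by linarith)

lemma UnifElliptic.lintegral_ball_sq_le {s lam Lam : ℝ} {K : Measure (Euc n)}
    (hK : UnifElliptic s lam Lam K) (hL : 0 ≤ Lam) (hs : s < 1) {ρ : ℝ} (hρ : 0 < ρ) :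
    ∫⁻ y in ball 0 ρ, ENNReal.ofReal (‖y‖ ^ 2) ∂K ≤
      ENNReal.ofReal (momentConst s 2 (1 / 2) Lam * ρ ^ (2 - 2 * s)) := by
  have h := hK.lintegral_rpow_le hL two_pos (by norm_num) (half_rpow_lt_one hs) (half_pos hρ)
    (ball_subset_iUnion_ring hρ)
  simp only [Real.rpow_two] at h
  refine h.trans (ENNReal.ofReal_le_ofReal ?_)
  have := momentConst_nonneg hL (half_rpow_lt_one hs)
  gcongr
  · linarith
  · linarith

lemma integrableOn_and_setIntegral_le_of_lintegral_le {K : Measure (Euc n)} {S : Set (Euc n)}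
    {g : Euc n → ℝ} (hg : Continuous g) (hg0 : ∀ y, 0 ≤ g y) {c : ℝ} (hc : 0 ≤ c)
    (h : ∫⁻ y in S, ENNReal.ofReal (g y) ∂K ≤ ENNReal.ofReal c) :
    IntegrableOn g S K ∧ ∫ y in S, g y ∂K ≤ c := by
  refine ⟨⟨hg.aestronglyMeasurable, ?_⟩, ?_⟩
  · rw [hasFiniteIntegral_iff_ofReal (.of_forall hg0)]
    exact h.trans_lt ENNReal.ofReal_lt_top
  · rw [integral_eq_lintegral_of_nonneg_ae (.of_forall hg0) hg.aestronglyMeasurable]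
    exact ENNReal.toReal_le_of_le_ofReal hc h

lemma UnifElliptic.integral_ball_sq {s lam Lam : ℝ} {K : Measure (Euc n)}
    (hK : UnifElliptic s lam Lam K) (hL : 0 ≤ Lam) (hs : s < 1) {ρ : ℝ} (hρ : 0 < ρ) :
    IntegrableOn (fun y => ‖y‖ ^ 2) (ball 0 ρ) K ∧
      ∫ y in ball 0 ρ, ‖y‖ ^ 2 ∂K ≤ momentConst s 2 (1 / 2) Lam * ρ ^ (2 - 2 * s) :=
  integrableOn_and_setIntegral_le_of_lintegral_le (by fun_prop) (fun _ => by positivity)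
    (mul_nonneg (momentConst_nonneg hL (half_rpow_lt_one hs)) (Real.rpow_nonneg hρ.le _))
    (hK.lintegral_ball_sq_le hL hs hρ)

lemma UnifElliptic.integral_compl_ball_rpow {s lam Lam : ℝ} {K : Measure (Euc n)}
    (hK : UnifElliptic s lam Lam K) (hL : 0 ≤ Lam) {β : ℝ} (hβ : β ∈ Ioo 0 (2 * s)) {ρ : ℝ}
    (hρ : 0 < ρ) :
    IntegrableOn (fun y => ‖y‖ ^ β) (ball 0 ρ)ᶜ K ∧
      ∫ y in (ball 0 ρ)ᶜ, ‖y‖ ^ β ∂K ≤ momentConst s β 2 Lam * ρ ^ (β - 2 * s) :=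
  integrableOn_and_setIntegral_le_of_lintegral_le
    (continuous_norm.rpow_const fun _ => .inr hβ.1.le) (fun _ => by positivity)
    (mul_nonneg (momentConst_nonneg hL (two_rpow_lt_one hβ.2)) (Real.rpow_nonneg hρ.le _))
    (hK.lintegral_rpow_le hL hβ.1 two_pos (two_rpow_lt_one hβ.2) hρ
      ((compl_ball_eq_iUnion_ring hρ).subset.trans subset_union_right))

/-- The part of the annulus `B_r ∖ B_{τr}` where the angle with `± e` is not too large. -/
def coneAnnulus (e : Euc n) (κ τ r : ℝ) : Set (Euc n) :=
  {y | τ * r ≤ ‖y‖ ∧ ‖y‖ < r ∧ κ * ‖y‖ ≤ |⟪e, y⟫|}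

lemma measurableSet_coneAnnulus (e : Euc n) (κ τ r : ℝ) :
    MeasurableSet (coneAnnulus e κ τ r) := by
  refine (measurableSet_le (f := fun _ : Euc n => τ * r) (g := fun y => ‖y‖)
    (by fun_prop) (by fun_prop)).inter ((measurableSet_lt (f := fun y : Euc n => ‖y‖)
      (g := fun _ => r) (by fun_prop) (by fun_prop)).inter
        (measurableSet_le (f := fun y : Euc n => κ * ‖y‖) (g := fun y => |⟪e, y⟫|)
          (by fun_prop) (by fun_prop)))

lemma exists_le_measure_coneAnnulus {s lam Lam : ℝ} (hs : s < 1) (hlam : 0 < lam)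
    (hL : 0 ≤ Lam) :
    ∃ κ > 0, ∃ τ ∈ Ioo (0 : ℝ) 1, ∀ K : Measure (Euc n), UnifElliptic s lam Lam K →
      ∀ r > 0, ∀ e : Euc n, ‖e‖ = 1 →
        ENNReal.ofReal (lam / 4 * r ^ (-(2 * s))) ≤ K (coneAnnulus e κ τ r) := by
  set C := momentConst s 2 (1 / 2) Lam with hC
  have hC0 : 0 ≤ C := momentConst_nonneg hL (half_rpow_lt_one hs)
  obtain ⟨κ, hκ, hκ'⟩ : ∃ κ > 0, κ ^ 2 * C ≤ lam / 4 := by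
    refine ⟨√(lam / (4 * (C + 1))), by positivity, ?_⟩
    rw [Real.sq_sqrt (by positivity), div_mul_eq_mul_div, div_le_div_iff₀ (by positivity) four_pos]
    nlinarith
  obtain ⟨τ, hτ, hτ'⟩ : ∃ τ ∈ Ioo (0 : ℝ) 1, C * τ ^ (2 - 2 * s) ≤ lam / 4 := by
    have hlim : Filter.Tendsto (fun τ : ℝ => C * τ ^ (2 - 2 * s)) (𝓝[>] 0) (𝓝 0) := by
      have hc : ContinuousAt (fun τ : ℝ => C * τ ^ (2 - 2 * s)) 0 :=
        continuousAt_const.mul (Real.continuousAt_rpow_const _ _ (.inr (by linarith)))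
      have := hc.tendsto
      rw [Real.zero_rpow (by linarith), mul_zero] at this
      exact this.mono_left nhdsWithin_le_nhds
    obtain ⟨τ, h1, h2⟩ :=
      ((hlim.eventually (ge_mem_nhds (show (0 : ℝ) < lam / 4 by positivity))).and
      (Ioo_mem_nhdsGT one_pos)).exists
    exact ⟨τ, h2, h1⟩
  refine ⟨κ, hκ, τ, hτ, fun K hK r hr e he => ?_⟩
  set P : ℝ := r ^ (2 - 2 * s) with hP
  have hP0 : 0 < P := Real.rpow_pos_of_pos hr _
  have hinner : ∀ y : Euc n, ⟪e, y⟫ ^ 2 ≤ ‖y‖ ^ 2 := fun y => by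
    have := abs_real_inner_le_norm e y
    rw [he, one_mul] at this
    exact sq_le_sq.2 (this.trans_eq (abs_norm y).symm)
  have hlow : ENNReal.ofReal (lam * P) ≤ ∫⁻ y in ball 0 r, ENNReal.ofReal (⟪e, y⟫ ^ 2) ∂K := by
    have h := hK.2 r hr e he
    calc _ = ENNReal.ofReal P * ENNReal.ofReal lam := by
          rw [mul_comm, ENNReal.ofReal_mul hP0.le]
      _ ≤ ENNReal.ofReal P * (ENNReal.ofReal (r ^ (2 * s - 2)) *
            ∫⁻ y in ball 0 r, ENNReal.ofReal (⟪e, y⟫ ^ 2) ∂K) := by gcongr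
      _ = _ := by
          rw [← mul_assoc, ← ENNReal.ofReal_mul hP0.le, hP, ← Real.rpow_add hr]
          norm_num
  have hcover : ball (0 : Euc n) r ⊆ coneAnnulus e κ τ r ∪
      ({y | |⟪e, y⟫| < κ * ‖y‖} ∩ ball 0 r ∪ ball 0 (τ * r)) := fun y hy => by
    by_cases h1 : ‖y‖ < τ * r
    · exact .inr (.inr (mem_ball_zero_iff.2 h1))
    by_cases h2 : |⟪e, y⟫| < κ * ‖y‖
    · exact .inr (.inl ⟨h2, hy⟩)
    · exact .inl ⟨not_lt.1 h1, mem_ball_zero_iff.1 hy, not_lt.1 h2⟩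
  have hT : ∫⁻ y in coneAnnulus e κ τ r, ENNReal.ofReal (⟪e, y⟫ ^ 2) ∂K ≤
      ENNReal.ofReal (r ^ 2) * K (coneAnnulus e κ τ r) := by
    rw [← setLIntegral_const]
    refine setLIntegral_mono' (measurableSet_coneAnnulus e κ τ r) fun y hy => ?_
    refine ENNReal.ofReal_le_ofReal ((hinner y).trans ?_)
    have := hy.2.1
    gcongr
  have hV : ∫⁻ y in {y | |⟪e, y⟫| < κ * ‖y‖} ∩ ball 0 r, ENNReal.ofReal (⟪e, y⟫ ^ 2) ∂K ≤
      ENNReal.ofReal (lam / 4 * P) := by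
    have hm : MeasurableSet ({y : Euc n | |⟪e, y⟫| < κ * ‖y‖} ∩ ball 0 r) :=
      (isOpen_lt (by fun_prop) (by fun_prop)).measurableSet.inter measurableSet_ball
    calc _ ≤ ∫⁻ y in {y | |⟪e, y⟫| < κ * ‖y‖} ∩ ball 0 r,
          ENNReal.ofReal (κ ^ 2) * ENNReal.ofReal (‖y‖ ^ 2) ∂K := by
          refine setLIntegral_mono' hm fun y hy => ?_
          rw [← ENNReal.ofReal_mul (by positivity), ← mul_pow, ← sq_abs ⟪e, y⟫]
          have : |⟪e, y⟫| < κ * ‖y‖ := hy.1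
          gcongr
      _ ≤ ∫⁻ y in ball 0 r, ENNReal.ofReal (κ ^ 2) * ENNReal.ofReal (‖y‖ ^ 2) ∂K :=
          lintegral_mono_set inter_subset_right
      _ = ENNReal.ofReal (κ ^ 2) * ∫⁻ y in ball 0 r, ENNReal.ofReal (‖y‖ ^ 2) ∂K :=
          lintegral_const_mul _ (by fun_prop)
      _ ≤ ENNReal.ofReal (κ ^ 2) * ENNReal.ofReal (C * P) := by
          gcongr; exact hK.lintegral_ball_sq_le hL hs hr
      _ ≤ _ := by
          rw [← ENNReal.ofReal_mul (by positivity), ← mul_assoc]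
          gcongr
  have hB : ∫⁻ y in ball 0 (τ * r), ENNReal.ofReal (⟪e, y⟫ ^ 2) ∂K ≤
      ENNReal.ofReal (lam / 4 * P) := by
    calc _ ≤ ∫⁻ y in ball 0 (τ * r), ENNReal.ofReal (‖y‖ ^ 2) ∂K :=
          lintegral_mono fun y => ENNReal.ofReal_le_ofReal (hinner y)
      _ ≤ _ := hK.lintegral_ball_sq_le hL hs (mul_pos hτ.1 hr)
      _ ≤ _ := by
          rw [Real.mul_rpow hτ.1.le hr.le, ← mul_assoc]
          gcongr
  have hsum : ENNReal.ofReal (lam * P) ≤ ENNReal.ofReal (r ^ 2) * K (coneAnnulus e κ τ r) +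
      (ENNReal.ofReal (lam / 4 * P) + ENNReal.ofReal (lam / 4 * P)) :=
    hlow.trans <| (lintegral_mono_set hcover).trans <| (lintegral_union_le _ _ _).trans <|
      add_le_add hT ((lintegral_union_le _ _ _).trans (add_le_add hV hB))
  by_contra! hlt
  have hr2 : ENNReal.ofReal (r ^ 2) * K (coneAnnulus e κ τ r) ≤ ENNReal.ofReal (lam / 4 * P) := by
    calc _ ≤ ENNReal.ofReal (r ^ 2) * ENNReal.ofReal (lam / 4 * r ^ (-(2 * s))) := by gcongr
      _ = _ := by
        rw [← ENNReal.ofReal_mul (by positivity), hP, sub_eq_add_neg, Real.rpow_add hr,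
          Real.rpow_two]
        ring_nf
  have h4 : 0 ≤ lam / 4 * P := by positivity
  have := hsum.trans (add_le_add_left hr2 _)
  rw [← ENNReal.ofReal_add h4 h4, ← ENNReal.ofReal_add h4 (add_nonneg h4 h4),
    ENNReal.ofReal_le_ofReal_iff (by positivity)] at this
  nlinarith [mul_pos hlam hP0]

lemma KantCond.abs_integral_sub_le {s β δ : ℝ} (hβ : β ∈ Ioo 0 (2 * s)) {μ ν : Measure (Euc n)}
    (h : KantCond s β μ ν δ) {φ : Euc n → ℝ} (hφ : HolderUnit β fun y => φ y / 2)
    (hφ0 : φ 0 = 0) {r : ℝ} (hr : 0 < r) (hμ : IntegrableOn φ (ball 0 r)ᶜ μ)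
    (hν : IntegrableOn φ (ball 0 r)ᶜ ν) :
    |(∫ y in (ball 0 r)ᶜ, φ y ∂μ) - ∫ y in (ball 0 r)ᶜ, φ y ∂ν| ≤
      2 * (1 - (2 : ℝ) ^ (β - 2 * s))⁻¹ * r ^ (β - 2 * s) * δ := by
  have hm : ∀ j : ℕ, MeasurableSet (ball (0 : Euc n) (2 * (r * 2 ^ j)) \ ball 0 (r * 2 ^ j)) :=
    fun j => measurableSet_ball.diff measurableSet_ball
  have hdisj : Pairwise (Function.onFun Disjoint fun j : ℕ =>
      ball (0 : Euc n) (2 * (r * 2 ^ j)) \ ball 0 (r * 2 ^ j)) := by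
    refine (pairwise_disjoint_on _).2 fun i j hij => ?_
    refine disjoint_left.2 fun y hi hj => hj.2 (ball_subset_ball ?_ hi.1)
    have : (2 : ℝ) ^ (i + 1) ≤ 2 ^ j := pow_le_pow_right₀ one_le_two hij
    rw [pow_succ] at this
    nlinarith
  rw [compl_ball_eq_iUnion_ring hr] at hμ hν ⊢
  have hd := (hasSum_integral_iUnion hm hdisj hμ).sub (hasSum_integral_iUnion hm hdisj hν)
  have hq : 0 < (2 : ℝ) ^ (β - 2 * s) := by positivity
  have hg := (hasSum_geometric_of_lt_one hq.le (two_rpow_lt_one hβ.2)).mul_left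
    (2 * δ * r ^ (β - 2 * s))
  have hle := tsum_of_norm_bounded hg (f := fun j : ℕ =>
    (∫ y in ball 0 (2 * (r * 2 ^ j)) \ ball 0 (r * 2 ^ j), φ y ∂μ) -
      ∫ y in ball 0 (2 * (r * 2 ^ j)) \ ball 0 (r * 2 ^ j), φ y ∂ν) fun j => by
    have hk := h (r * 2 ^ j) (by positivity) _ hφ.1 hφ.2 (by simp [hφ0])
    rw [integral_div, integral_div, ← sub_div, abs_div, abs_two,
      Real.mul_rpow hr.le (by positivity)] at hk
    have e : ((2 : ℝ) ^ (β - 2 * s)) ^ j = (2 ^ j) ^ (β - 2 * s) := by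
      rw [← Real.rpow_natCast, ← Real.rpow_natCast, ← Real.rpow_mul two_pos.le,
        ← Real.rpow_mul two_pos.le, mul_comm]
    rw [Real.norm_eq_abs, e]
    linarith
  rw [hd.tsum_eq, Real.norm_eq_abs] at hle
  exact hle.trans_eq (by ring)

/-- The penalised objective used to double variables in the equation of a second difference. -/
def penalized (a : Euc n → ℝ) (h z : Euc n) (N θ : ℝ) (x₁ x₂ x₃ : Euc n) : ℝ :=
  a x₁ + a x₃ - 2 * a x₂ - N * (‖x₁ - x₂ - h‖ ^ 2 + ‖x₃ - x₂ + h‖ ^ 2) - θ * ‖x₂ - z‖ ^ 2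

lemma norm_add_sq_add_norm_sub_sq (v y : Euc n) :
    ‖v + y‖ ^ 2 + ‖v - y‖ ^ 2 = 2 * ‖v‖ ^ 2 + 2 * ‖y‖ ^ 2 := by
  rw [norm_add_sq_real, norm_sub_sq_real]; ring

lemma exists_penalized_isMax {a : Euc n → ℝ} (ha : Continuous a) (h z : Euc n) (N θ : ℝ) :
    ∃ x₁ ∈ closedBall (z + h) 1, ∃ x₂ ∈ closedBall z 1, ∃ x₃ ∈ closedBall (z - h) 1,
      ∀ y₁ ∈ closedBall (z + h) 1, ∀ y₂ ∈ closedBall z 1, ∀ y₃ ∈ closedBall (z - h) 1,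
        penalized a h z N θ y₁ y₂ y₃ ≤ penalized a h z N θ x₁ x₂ x₃ := by
  have hc : Continuous fun x : Euc n × Euc n × Euc n => penalized a h z N θ x.1 x.2.1 x.2.2 := by
    unfold penalized; fun_prop
  have hcomp := (isCompact_closedBall (z + h) 1).prod
    ((isCompact_closedBall z 1).prod (isCompact_closedBall (z - h) 1))
  obtain ⟨x, hx, hmax⟩ := hcomp.exists_isMaxOn
    ⟨(z + h, z, z - h), by simp⟩ hc.continuousOn
  exact ⟨x.1, hx.1, x.2.1, hx.2.1, x.2.2, hx.2.2, fun y₁ h₁ y₂ h₂ y₃ h₃ =>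
    hmax (show (y₁, y₂, y₃) ∈ _ from ⟨h₁, h₂, h₃⟩)⟩

lemma exists_penalization {w : Euc n → ℝ} (hw : Continuous w) {h z : Euc n} {M : ℝ}
    (hM : ∀ x, secondDiff w x h ≤ M) (hz : secondDiff w z h = M) {θ σ : ℝ} (hθ : 0 < θ)
    (hσ : 0 < σ) :
    ∃ N > 0, ∃ ε > 0, ∀ a : Euc n → ℝ, Continuous a →
      (∀ x ∈ closedBall (0 : Euc n) (‖z‖ + ‖h‖ + 1), |a x - w x| ≤ ε) →
      ∃ x₁ x₂ x₃, ‖x₁ - (z + h)‖ ≤ σ ∧ ‖x₂ - z‖ ≤ σ ∧ ‖x₃ - (z - h)‖ ≤ σ ∧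
        ∀ y₁ ∈ closedBall (z + h) 1, ∀ y₂ ∈ closedBall z 1, ∀ y₃ ∈ closedBall (z - h) 1,
          penalized a h z N θ y₁ y₂ y₃ ≤ penalized a h z N θ x₁ x₂ x₃ := by
  set B := closedBall (0 : Euc n) (‖z‖ + ‖h‖ + 1) with hB
  have hsub : ∀ v : Euc n, ‖v‖ ≤ ‖h‖ → closedBall (z + v) 1 ⊆ B := fun v hv =>
    closedBall_subset_closedBall' (by
      rw [dist_zero_right]
      linarith [norm_add_le z v])
  have hBc : IsCompact B := isCompact_closedBall _ _
  obtain ⟨W, hW⟩ := hBc.exists_bound_of_continuousOn hw.continuousOn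
  have hW0 : 0 ≤ W := (norm_nonneg _).trans (hW 0 (mem_closedBall_self (by positivity)))
  set m := θ * σ ^ 2 / 16 with hm
  have hm0 : 0 < m := by positivity
  obtain ⟨η, hη, huc⟩ := Metric.uniformContinuousOn_iff_le.1
    (hBc.uniformContinuousOn_of_continuous hw.continuousOn) m hm0
  set t := min η (σ / 2) with ht
  have ht0 : 0 < t := lt_min hη (half_pos hσ)
  refine ⟨(4 * W + 8) / t ^ 2, by positivity, min 1 (θ * σ ^ 2 / 64), by positivity,
    fun a ha hclose => ?_⟩
  set N := (4 * W + 8) / t ^ 2 with hN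
  have hN0 : 0 < N := by positivity
  obtain ⟨x₁, h₁, x₂, h₂, x₃, h₃, hmax⟩ := exists_penalized_isMax ha h z N θ
  have hB1 : x₁ ∈ B := hsub h le_rfl h₁
  have hB2 : x₂ ∈ B := hsub 0 (by simp) (by simpa using h₂)
  have hB3 : x₃ ∈ B := hsub (-h) (by simp) (by simpa [sub_eq_add_neg] using h₃)
  have hz1 : z + h ∈ B := hsub h le_rfl (mem_closedBall_self zero_le_one)
  have hz2 : z ∈ B := hsub 0 (by simp) (by simp)
  have hz3 : z - h ∈ B := hsub (-h) (by simp) (by simp [sub_eq_add_neg])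
  have hB4 : x₂ + h ∈ B := hsub h le_rfl (by simpa [dist_eq_norm] using h₂)
  have hB5 : x₂ - h ∈ B := hsub (-h) (by simp) (by
    simpa [dist_eq_norm, sub_eq_add_neg] using h₂)
  set ε := min 1 (θ * σ ^ 2 / 64) with hε
  have hε1 : ε ≤ 1 := min_le_left _ _
  have hε2 : ε ≤ θ * σ ^ 2 / 64 := min_le_right _ _
  have key : N * (‖x₁ - x₂ - h‖ ^ 2 + ‖x₃ - x₂ + h‖ ^ 2) + θ * ‖x₂ - z‖ ^ 2 ≤
      (w x₁ - w (x₂ + h)) + (w x₃ - w (x₂ - h)) + 8 * ε := by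
    have hle := hmax (z + h) (mem_closedBall_self zero_le_one) z (mem_closedBall_self zero_le_one)
      (z - h) (mem_closedBall_self zero_le_one)
    simp only [penalized, add_sub_cancel_left, sub_self, norm_zero, sub_sub_cancel_left,
      neg_add_cancel] at hle
    have hgx := hM x₂
    simp only [secondDiff] at hgx hz
    have c1 := abs_le.1 (hclose x₁ hB1)
    have c2 := abs_le.1 (hclose x₂ hB2)
    have c3 := abs_le.1 (hclose x₃ hB3)
    have d1 := abs_le.1 (hclose _ hz1)
    have d2 := abs_le.1 (hclose _ hz2)
    have d3 := abs_le.1 (hclose _ hz3)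
    linarith [c1.1, c1.2, c2.1, c2.2, c3.1, c3.2, d1.1, d1.2, d2.1, d2.2, d3.1, d3.2]
  have hsq : 0 ≤ θ * ‖x₂ - z‖ ^ 2 := by positivity
  have hp : N * (‖x₁ - x₂ - h‖ ^ 2 + ‖x₃ - x₂ + h‖ ^ 2) ≤ 4 * W + 8 := by
    have e1 := abs_le.1 (hW _ hB1)
    have e3 := abs_le.1 (hW _ hB3)
    have e4 := abs_le.1 (hW _ hB4)
    have e5 := abs_le.1 (hW _ hB5)
    linarith [e1.2, e3.2, e4.1, e5.1]
  rw [hN, div_mul_eq_mul_div, div_le_iff₀ (by positivity), mul_le_mul_iff_right₀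
    (by positivity)] at hp
  have hp1 : ‖x₁ - x₂ - h‖ ≤ t :=
    (pow_le_pow_iff_left₀ (norm_nonneg _) ht0.le two_ne_zero).1
      (by nlinarith [sq_nonneg ‖x₃ - x₂ + h‖])
  have hp3 : ‖x₃ - x₂ + h‖ ≤ t :=
    (pow_le_pow_iff_left₀ (norm_nonneg _) ht0.le two_ne_zero).1
      (by nlinarith [sq_nonneg ‖x₁ - x₂ - h‖])
  have hw1 := huc x₁ hB1 (x₂ + h) hB4 (by
    rw [dist_eq_norm, ← sub_sub]; exact hp1.trans (min_le_left _ _))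
  have hw3 := huc x₃ hB3 (x₂ - h) hB5 (by
    rw [dist_eq_norm, ← sub_add]; exact hp3.trans (min_le_left _ _))
  rw [Real.dist_eq] at hw1 hw3
  have hN' : 0 ≤ N * (‖x₁ - x₂ - h‖ ^ 2 + ‖x₃ - x₂ + h‖ ^ 2) := by positivity
  have hz' : ‖x₂ - z‖ ≤ σ / 2 := by
    have : θ * ‖x₂ - z‖ ^ 2 ≤ θ * (σ / 2) ^ 2 := by
      have a1 := (abs_le.1 hw1).2
      have a3 := (abs_le.1 hw3).2
      linarith
    exact (pow_le_pow_iff_left₀ (norm_nonneg _) (by positivity) two_ne_zero).1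
      ((mul_le_mul_iff_right₀ hθ).1 this)
  have htσ : t ≤ σ / 2 := min_le_right _ _
  refine ⟨x₁, x₂, x₃, ?_, by linarith, ?_, hmax⟩
  · have : x₁ - (z + h) = (x₁ - x₂ - h) + (x₂ - z) := by abel
    rw [this]
    linarith [norm_add_le (x₁ - x₂ - h) (x₂ - z)]
  · have : x₃ - (z - h) = (x₃ - x₂ + h) + (x₂ - z) := by abel
    rw [this]
    linarith [norm_add_le (x₃ - x₂ + h) (x₂ - z)]

lemma secondDiff_le_of_penalized_isMax {a : Euc n → ℝ} {h z : Euc n} {N θ : ℝ}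
    {x₁ x₂ x₃ : Euc n} (h₁ : ‖x₁ - (z + h)‖ ≤ 1 / 2) (h₂ : ‖x₂ - z‖ ≤ 1 / 2)
    (h₃ : ‖x₃ - (z - h)‖ ≤ 1 / 2)
    (hmax : ∀ y₁ ∈ closedBall (z + h) 1, ∀ y₂ ∈ closedBall z 1, ∀ y₃ ∈ closedBall (z - h) 1,
      penalized a h z N θ y₁ y₂ y₃ ≤ penalized a h z N θ x₁ x₂ x₃) {y : Euc n}
    (hy : ‖y‖ ≤ 1 / 2) :
    secondDiff a x₁ y ≤ 2 * N * ‖y‖ ^ 2 ∧ secondDiff a x₃ y ≤ 2 * N * ‖y‖ ^ 2 ∧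
      -2 * secondDiff a x₂ y ≤ (4 * N + 2 * θ) * ‖y‖ ^ 2 ∧
      secondDiff a x₁ y + secondDiff a x₃ y - 2 * secondDiff a x₂ y ≤ 2 * θ * ‖y‖ ^ 2 := by
  have mem : ∀ {x c v : Euc n}, ‖x - c‖ ≤ 1 / 2 → ‖v‖ ≤ 1 / 2 → x + v ∈ closedBall c 1 := by
    intro x c v hx hv
    rw [mem_closedBall, dist_eq_norm, add_sub_right_comm]
    linarith [norm_add_le (x - c) v]
  have hn : ‖-y‖ ≤ 1 / 2 := by rwa [norm_neg]
  have h0 : ‖(0 : Euc n)‖ ≤ 1 / 2 := by simp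
  have A := hmax _ (mem h₁ hy) _ (mem h₂ h0) _ (mem h₃ h0)
  have A' := hmax _ (mem h₁ hn) _ (mem h₂ h0) _ (mem h₃ h0)
  have B := hmax _ (mem h₁ h0) _ (mem h₂ hy) _ (mem h₃ h0)
  have B' := hmax _ (mem h₁ h0) _ (mem h₂ hn) _ (mem h₃ h0)
  have C := hmax _ (mem h₁ h0) _ (mem h₂ h0) _ (mem h₃ hy)
  have C' := hmax _ (mem h₁ h0) _ (mem h₂ h0) _ (mem h₃ hn)
  have D := hmax _ (mem h₁ hy) _ (mem h₂ hy) _ (mem h₃ hy)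
  have D' := hmax _ (mem h₁ hn) _ (mem h₂ hn) _ (mem h₃ hn)
  have p := norm_add_sq_add_norm_sub_sq (x₁ - x₂ - h) y
  have q := norm_add_sq_add_norm_sub_sq (x₃ - x₂ + h) y
  have k := norm_add_sq_add_norm_sub_sq (x₂ - z) y
  have e1 : x₁ + y - x₂ - h = x₁ - x₂ - h + y := by abel
  have e2 : x₁ + -y - x₂ - h = x₁ - x₂ - h - y := by abel
  have e3 : x₁ - (x₂ + y) - h = x₁ - x₂ - h - y := by abel
  have e4 : x₁ - (x₂ + -y) - h = x₁ - x₂ - h + y := by abel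
  have e5 : x₃ + y - x₂ + h = x₃ - x₂ + h + y := by abel
  have e6 : x₃ + -y - x₂ + h = x₃ - x₂ + h - y := by abel
  have e7 : x₃ - (x₂ + y) + h = x₃ - x₂ + h - y := by abel
  have e8 : x₃ - (x₂ + -y) + h = x₃ - x₂ + h + y := by abel
  have e9 : x₂ + y - z = x₂ - z + y := by abel
  have e10 : x₂ + -y - z = x₂ - z - y := by abel
  simp only [penalized, add_zero, add_sub_add_right_eq_sub, e1, e2, e3, e4, e5, e6, e7, e8, e9,
    e10] at A A' B B' C C' D D'
  simp only [← sub_eq_add_neg] at A A' B B' C C' D D'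
  simp only [secondDiff]
  have p' := congrArg (N * ·) p
  have q' := congrArg (N * ·) q
  have k' := congrArg (θ * ·) k
  refine ⟨?_, ?_, ?_, ?_⟩ <;> linarith

lemma le_integral_compl_ball_secondDiff {s β lam Lam m : ℝ} (hs : s ∈ Ioo 0 1)
    (hβ : β ∈ Ioo 0 (2 * s)) (hβ1 : β ≠ 1) (hL : 0 ≤ Lam)
    {μ ν : Measure (Euc n)} (hμ : UnifElliptic s lam Lam μ) (hν : UnifElliptic s lam Lam ν)
    (hK : KantCond s β μ ν (1 / m)) {a : Euc n → ℝ} (ha : HolderUnit β a) {x : Euc n}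
    (hi : Integrable (secondDiff a x) μ) (hx : |∫ y, secondDiff a x y ∂μ| ≤ 2 / m)
    {c q r : ℝ} (hr : 0 < r) (hq : 0 ≤ q)
    (hle : ∀ y ∈ ball (0 : Euc n) r, c * secondDiff a x y ≤ q * ‖y‖ ^ 2) :
    -(|c| * ((2 + 2 * (1 - (2 : ℝ) ^ (β - 2 * s))⁻¹ * r ^ (β - 2 * s)) * (1 / m))) -
        q * (momentConst s 2 (1 / 2) Lam * r ^ (2 - 2 * s)) ≤
      ∫ y in (ball 0 r)ᶜ, c * secondDiff a x y ∂ν := by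
  have hβ2 : β ∈ Ioo 0 2 := ⟨hβ.1, by linarith [hβ.2, hs.2]⟩
  have hν' : IntegrableOn (secondDiff a x) (ball 0 r)ᶜ ν := by
    refine ((hν.integral_compl_ball_rpow hL hβ hr).1.const_mul 2).mono'
      (continuous_secondDiff ha.continuous x).aestronglyMeasurable (.of_forall fun y => ?_)
    exact ha.abs_secondDiff_le hβ2 hβ1 x y
  have hk := hK.abs_integral_sub_le hβ (ha.secondDiff_div_two hβ2 hβ1 x) (secondDiff_zero a x) hr
    hi.integrableOn hν'
  have hsq := hμ.integral_ball_sq hL hs.2 hr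
  have hsplit := integral_add_compl (measurableSet_ball (x := (0 : Euc n)) (ε := r))
    (hi.const_mul c)
  have hin : ∫ y in ball 0 r, c * secondDiff a x y ∂μ ≤
      q * (momentConst s 2 (1 / 2) Lam * r ^ (2 - 2 * s)) := by
    calc _ ≤ ∫ y in ball 0 r, q * ‖y‖ ^ 2 ∂μ :=
          setIntegral_mono_on (hi.const_mul c).integrableOn (hsq.1.const_mul q)
            measurableSet_ball hle
      _ ≤ _ := by
          rw [integral_const_mul]
          exact mul_le_mul_of_nonneg_left hsq.2 hq
  simp only [integral_const_mul] at hsplit hin ⊢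
  have h1 := (abs_le.1 ((abs_mul c _).trans_le (mul_le_mul_of_nonneg_left hx (abs_nonneg c)))).1
  have h2 := (abs_le.1 ((abs_mul c _).trans_le (mul_le_mul_of_nonneg_left hk (abs_nonneg c)))).2
  have e : |c| * (2 / m) = |c| * (2 * (1 / m)) := by ring
  rw [e] at h1
  linarith

lemma integral_compl_ball_le_of_le {s β lam Lam : ℝ} (hs : s ∈ Ioo 0 1) (hβ : β ∈ Ioo 0 (2 * s))
    (hL : 0 ≤ Lam) {ν : Measure (Euc n)} (hν : UnifElliptic s lam Lam ν) {T : Set (Euc n)}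
    (hT : MeasurableSet T) {r A ω c₀ θ ε : ℝ} (hr : 0 < r) (hA : 0 < A)
    (hTr : T ⊆ (ball 0 r)ᶜ) (hT1 : T ⊆ ball 0 (1 / 2)) (hc₀ : ENNReal.ofReal c₀ ≤ ν T)
    (hω : 0 ≤ ω) (hθ : 0 ≤ θ) (hε : 0 ≤ ε)
    {E : Euc n → ℝ} (hE : IntegrableOn E (ball 0 r)ᶜ ν) (hET : ∀ y ∈ T, E y ≤ -ω)
    (hEs : ∀ y ∈ ball 0 (1 / 2), E y ≤ 2 * θ * ‖y‖ ^ 2)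
    (hEm : ∀ y ∈ (ball 0 (1 / 2))ᶜ, y ∈ ball 0 A → E y ≤ ε * ‖y‖ ^ β)
    (hEl : ∀ y, E y ≤ 8 * ‖y‖ ^ β) :
    ∫ y in (ball 0 r)ᶜ, E y ∂ν ≤ -(ω * c₀) +
      2 * θ * (momentConst s 2 (1 / 2) Lam * (1 / 2) ^ (2 - 2 * s)) +
      ε * (momentConst s β 2 Lam * (1 / 2) ^ (β - 2 * s)) +
      8 * (momentConst s β 2 Lam * A ^ (β - 2 * s)) := by
  obtain ⟨i1, j1⟩ := hν.integral_ball_sq hL hs.2 (one_half_pos (α := ℝ))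
  obtain ⟨i2, j2⟩ := hν.integral_compl_ball_rpow hL hβ (one_half_pos (α := ℝ))
  obtain ⟨i3, j3⟩ := hν.integral_compl_ball_rpow hL hβ hA
  have hTfin : ν T < ∞ := by
    have hsub : T ⊆ {y | r ^ β ≤ ‖y‖ ^ β} ∩ (ball 0 r)ᶜ := fun y hy =>
      ⟨Real.rpow_le_rpow hr.le (by simpa using hTr hy) hβ.1.le, hTr hy⟩
    have h3 := (hν.integral_compl_ball_rpow hL hβ hr).1
    have := h3.measure_ge_lt_top (Real.rpow_pos_of_pos hr β)
    rw [Measure.restrict_apply₀' measurableSet_ball.compl.nullMeasurableSet] at this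
    exact (measure_mono hsub).trans_lt this
  have hTreal : c₀ ≤ ν.real T := (ENNReal.ofReal_le_iff_le_toReal hTfin.ne).1 hc₀
  have iT : Integrable (T.indicator fun _ => -ω) ν :=
    (integrable_indicator_iff hT).2 (integrableOn_const hTfin.ne)
  have k1 := (integrable_indicator_iff measurableSet_ball).2 (i1.const_mul (2 * θ))
  have k2 := (integrable_indicator_iff measurableSet_ball.compl).2 (i2.const_mul (ε))
  have k3 := (integrable_indicator_iff measurableSet_ball.compl).2 (i3.const_mul (8))
  rw [← integral_indicator measurableSet_ball.compl]
  have hpt : ∀ y, (ball 0 r)ᶜ.indicator E y ≤ ((T.indicator (fun _ => -ω) y +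
      (ball 0 (1 / 2)).indicator (fun y => 2 * θ * ‖y‖ ^ 2) y) +
      (ball 0 (1 / 2))ᶜ.indicator (fun y => ε * ‖y‖ ^ β) y) +
      (ball 0 A)ᶜ.indicator (fun y => 8 * ‖y‖ ^ β) y := by
    intro y
    have n1 : 0 ≤ 2 * θ * ‖y‖ ^ 2 := by positivity
    have n2 : 0 ≤ ε * ‖y‖ ^ β := by positivity
    have n3 : 0 ≤ 8 * ‖y‖ ^ β := by positivity
    have n4 : 0 ≤ (ball 0 A)ᶜ.indicator (fun y : Euc n => 8 * ‖y‖ ^ β) y :=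
      indicator_nonneg (fun _ _ => by positivity) y
    by_cases hyr : y ∈ ball (0 : Euc n) r
    · have hyT : y ∉ T := fun h => hTr h hyr
      rw [indicator_of_notMem (by simpa using hyr), indicator_of_notMem hyT]
      have m1 : 0 ≤ (ball 0 (1 / 2)).indicator (fun y : Euc n => 2 * θ * ‖y‖ ^ 2) y :=
        indicator_nonneg (fun _ _ => by positivity) y
      have m2 : 0 ≤ (ball 0 (1 / 2))ᶜ.indicator (fun y : Euc n => ε * ‖y‖ ^ β) y :=
        indicator_nonneg (fun _ _ => by positivity) y
      linarith
    rw [indicator_of_mem (show y ∈ (ball (0 : Euc n) r)ᶜ from hyr)]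
    by_cases hy1 : y ∈ ball (0 : Euc n) (1 / 2)
    · rw [indicator_of_mem hy1,
        indicator_of_notMem (show y ∉ (ball (0 : Euc n) (1 / 2))ᶜ from fun h => h hy1)]
      by_cases hyT : y ∈ T
      · rw [indicator_of_mem hyT]
        linarith [hET y hyT]
      · rw [indicator_of_notMem hyT]
        linarith [hEs y hy1]
    · rw [indicator_of_notMem hy1, indicator_of_notMem fun h => hy1 (hT1 h),
        indicator_of_mem (show y ∈ (ball (0 : Euc n) (1 / 2))ᶜ from hy1)]
      by_cases hyA : y ∈ ball (0 : Euc n) A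
      · linarith [hEm y hy1 hyA]
      · rw [indicator_of_mem (show y ∈ (ball (0 : Euc n) A)ᶜ from hyA)]
        linarith [hEl y]
  calc _ ≤ _ := integral_mono ((integrable_indicator_iff measurableSet_ball.compl).2 hE)
        (((iT.add k1).add k2).add k3) hpt
    _ = ν.real T * -ω + 2 * θ * (∫ y in ball 0 (1 / 2), ‖y‖ ^ 2 ∂ν) +
        ε * (∫ y in (ball 0 (1 / 2))ᶜ, ‖y‖ ^ β ∂ν) + 8 * ∫ y in (ball 0 A)ᶜ, ‖y‖ ^ β ∂ν := by
        rw [integral_add' ((iT.add k1).add k2) k3, integral_add' (iT.add k1) k2,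
          integral_add' iT k1,
          integral_indicator hT, integral_indicator measurableSet_ball,
          integral_indicator measurableSet_ball.compl, integral_indicator measurableSet_ball.compl,
          integral_const_mul, integral_const_mul, integral_const_mul, setIntegral_const,
          smul_eq_mul]
    _ ≤ _ := by
        have t1 : 2 * θ * (∫ y in ball 0 (1 / 2), ‖y‖ ^ 2 ∂ν) ≤ _ :=
          mul_le_mul_of_nonneg_left j1 (by positivity)
        have t2 := mul_le_mul_of_nonneg_left j2 hε
        have t4 : ω * c₀ ≤ ω * ν.real T := by gcongr
        linarith

/-- Normalised functions solving an equation with small right-hand side on the ball of radius `m`,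
driven by kernels that oscillate by at most `1 / m`. -/
def Admissible (s β lam Lam m : ℝ) (a : Euc n → ℝ) : Prop :=
  HolderUnit β a ∧ TaylorZero β a ∧ ∃ K : Euc n → Measure (Euc n),
    (∀ x, UnifElliptic s lam Lam (K x)) ∧ (∀ x x', KantCond s β (K x) (K x') (1 / m)) ∧
      ∀ x ∈ ball 0 m, Integrable (secondDiff a x) (K x) ∧ |∫ y, secondDiff a x y ∂K x| ≤ 2 / m

/-- Locally uniform limits of admissible functions as the radius tends to infinity. -/
def LimitClass (s β lam Lam : ℝ) : Set (Euc n → ℝ) :=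
  {w | ∀ R m ε : ℝ, 0 < m → 0 < ε →
    ∃ a, Admissible s β lam Lam m a ∧ ∀ x ∈ closedBall 0 R, |a x - w x| ≤ ε}

lemma exists_mul_rpow_le {C p X ρ : ℝ} (hC : 0 ≤ C) (hp : 0 < p) (hX : 0 < X) (hρ : 0 < ρ) :
    ∃ r > 0, r ≤ ρ ∧ C * r ^ p ≤ X := by
  refine ⟨min ρ ((X / (C + 1)) ^ p⁻¹), by positivity, min_le_left _ _, ?_⟩
  calc C * (min ρ ((X / (C + 1)) ^ p⁻¹)) ^ p ≤ C * (((X / (C + 1)) ^ p⁻¹) ^ p) := by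
        gcongr
        exact min_le_right _ _
    _ = X * (C / (C + 1)) := by
        rw [Real.rpow_inv_rpow (by positivity) hp.ne']; ring
    _ ≤ X := mul_le_of_le_one_right hX.le ((div_le_one (by positivity)).2 (by linarith))

lemma secondDiff_secondDiff_comm (w : Euc n → ℝ) (z h y : Euc n) :
    secondDiff w (z + h) y + secondDiff w (z - h) y - 2 * secondDiff w z y =
      secondDiff w (z + y) h + secondDiff w (z - y) h - 2 * secondDiff w z h := by
  rw [secondDiff, secondDiff, secondDiff, secondDiff, secondDiff, secondDiff,
    add_right_comm z h y, add_sub_right_comm z h y, ← add_sub_right_comm z y h,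
    sub_right_comm z h y]
  ring

lemma abs_secondDiff_sub_le {a w : Euc n → ℝ} {ε σ R : ℝ}
    (h : ∀ p q : Euc n, ‖p‖ ≤ R → ‖q‖ ≤ R → ‖p - q‖ ≤ σ → |a p - w q| ≤ ε) {x z y : Euc n}
    (hxz : ‖x - z‖ ≤ σ) (hx : ‖x‖ + ‖y‖ ≤ R) (hz : ‖z‖ + ‖y‖ ≤ R) :
    |secondDiff a x y - secondDiff w z y| ≤ 4 * ε := by
  have hy := norm_nonneg y
  have h1 := abs_le.1 (h (x + y) (z + y) ((norm_add_le _ _).trans hx) ((norm_add_le _ _).trans hz)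
    (by simpa using hxz))
  have h2 := abs_le.1 (h (x - y) (z - y) ((norm_sub_le _ _).trans hx) ((norm_sub_le _ _).trans hz)
    (by simpa using hxz))
  have h3 := abs_le.1 (h x z (by linarith) (by linarith) hxz)
  simp only [secondDiff, abs_le]
  constructor <;> linarith

lemma LimitClass.continuous {s β lam Lam : ℝ} {w : Euc n → ℝ}
    (hw : w ∈ LimitClass s β lam Lam) : Continuous w := by
  refine continuous_iff_continuousAt.2 fun x =>
    continuousAt_of_locally_uniform_approx_of_continuousAt fun u hu => ?_
  obtain ⟨ε, hε, hu⟩ := Metric.mem_uniformity_dist.1 hu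
  obtain ⟨a, ha, haw⟩ := hw (‖x‖ + 1) 1 (ε / 2) one_pos (half_pos hε)
  refine ⟨closedBall 0 (‖x‖ + 1), mem_nhds_iff.2 ⟨1, one_pos, ?_⟩, a,
    ha.1.continuous.continuousAt, fun y hy => hu ?_⟩
  · exact ball_subset_closedBall.trans (closedBall_subset_closedBall' (by simp [add_comm]))
  · rw [dist_comm, Real.dist_eq]
    exact (haw y hy).trans_lt (half_lt_self hε)

lemma LimitClass.exists_le_of_isMax {s β lam Lam : ℝ} (hs : s ∈ Ioo 0 1)
    (hβ : β ∈ Ioo 0 (2 * s)) (hβ1 : β ≠ 1) (hL : 0 ≤ Lam) {w : Euc n → ℝ}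
    (hw : w ∈ LimitClass s β lam Lam) {h z : Euc n} {M : ℝ} (hM : ∀ x, secondDiff w x h ≤ M)
    (hz : secondDiff w z h = M) {T : Set (Euc n)} (hT : MeasurableSet T)
    (hT1 : T ⊆ ball 0 (1 / 2)) {t c₀ ω : ℝ} (ht : 0 < t) (hTt : T ⊆ (ball 0 t)ᶜ) (hc₀ : 0 < c₀)
    (hTK : ∀ K : Measure (Euc n), UnifElliptic s lam Lam K → ENNReal.ofReal c₀ ≤ K T)
    (hω : 0 < ω) : ∃ y ∈ T, -ω < secondDiff w (z + y) h + secondDiff w (z - y) h - 2 * M := by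
  by_contra! hcon
  have hwc := LimitClass.continuous hw
  have hβ2 : β ∈ Ioo 0 2 := ⟨hβ.1, by linarith [hβ.2, hs.2]⟩
  set C₁ := momentConst s 2 (1 / 2) Lam with hC₁
  set C₂ := momentConst s β 2 Lam with hC₂
  have hC₁0 : 0 ≤ C₁ := momentConst_nonneg hL (half_rpow_lt_one hs.2)
  have hC₂0 : 0 ≤ C₂ := momentConst_nonneg hL (two_rpow_lt_one hβ.2)
  set D := 2 * (1 - (2 : ℝ) ^ (β - 2 * s))⁻¹ with hD
  have hD0 : 0 < D := by
    have := sub_pos.2 (two_rpow_lt_one hβ.2)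
    positivity
  set X := ω / 2 * c₀ with hXdef
  have hX : 0 < X := by positivity
  obtain ⟨θ, hθ, -, hθX⟩ := exists_mul_rpow_le (C := 2 * (C₁ * (1 / 2) ^ (2 - 2 * s)))
    (by positivity) one_pos (show 0 < X / 8 by positivity) one_pos
  obtain ⟨ε₁, hε₁, -, hεX⟩ := exists_mul_rpow_le (C := C₂ * (1 / 2) ^ (β - 2 * s))
    (by positivity) one_pos (show 0 < X / 8 by positivity) one_pos
  rw [Real.rpow_one] at hθX hεX
  obtain ⟨A, hA, hAX⟩ : ∃ A, 1 / 2 ≤ A ∧ 8 * (C₂ * A ^ (β - 2 * s)) ≤ X / 8 := by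
    obtain ⟨r, hr, hr1, hrX⟩ := exists_mul_rpow_le (C := 8 * C₂) (by positivity)
      (show 0 < 2 * s - β by linarith [hβ.2]) (show 0 < X / 8 by positivity) one_pos
    refine ⟨r⁻¹, by linarith [(one_le_inv₀ hr).2 hr1], ?_⟩
    rwa [← neg_sub, Real.rpow_neg_eq_inv_rpow, inv_inv, ← mul_assoc]
  set ε₂ := min (ε₁ * (1 / 2) ^ β) (ω / 2) with hε₂
  have hε₂0 : 0 < ε₂ := by positivity
  set R := ‖z‖ + ‖h‖ + 1 + A with hR
  obtain ⟨σ, hσ, hσ2⟩ : ∃ σ > 0, ∀ p q : Euc n, ‖p‖ ≤ R → ‖q‖ ≤ R → ‖p - q‖ ≤ σ →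
      |w p - w q| ≤ ε₂ / 32 := by
    obtain ⟨σ, hσ, h2⟩ := Metric.uniformContinuousOn_iff_le.1
      ((isCompact_closedBall (0 : Euc n) R).uniformContinuousOn_of_continuous hwc.continuousOn)
      (ε₂ / 32) (by positivity)
    refine ⟨σ, hσ, fun p q hp hq hpq => ?_⟩
    rw [← Real.dist_eq]
    exact h2 p (by simpa using hp) q (by simpa using hq) (by rwa [dist_eq_norm])
  obtain ⟨N, hN, ε, hε, hpen⟩ := exists_penalization hwc hM hz hθ (lt_min hσ one_half_pos)
  obtain ⟨r, hr, hrt, hrX⟩ := exists_mul_rpow_le (C := (8 * N + 2 * θ) * C₁) (by positivity)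
    (show 0 < 2 - 2 * s by linarith [hs.2]) (show 0 < X / 8 by positivity)
    (lt_min ht one_half_pos)
  set m := (‖z‖ + ‖h‖ + 2) + (8 + 4 * (D * r ^ (β - 2 * s))) / (X / 8) with hm
  have hm0 : 0 < m := by positivity
  have hmX : (8 + 4 * (D * r ^ (β - 2 * s))) * (1 / m) ≤ X / 8 := by
    rw [mul_one_div, div_le_comm₀ hm0 (by positivity)]
    exact le_add_of_nonneg_left (by positivity)
  have hmz : ‖z‖ + ‖h‖ + 2 ≤ m := le_add_of_nonneg_right (by positivity)
  obtain ⟨a, ⟨haH, haT, K, hK, hKK, hKa⟩, haw⟩ := hw R m (min ε (ε₂ / 32)) hm0 (by positivity)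
  obtain ⟨x₁, x₂, x₃, h₁, h₂, h₃, hmax⟩ := hpen a haH.continuous fun x hx =>
    (haw x (closedBall_subset_closedBall (by linarith) hx)).trans (min_le_left _ _)
  have hσ' : min σ (1 / 2) ≤ 1 / 2 := min_le_right _ _
  have hσ'' : min σ (1 / 2) ≤ σ := min_le_left _ _
  have hz1 : ‖z + h‖ ≤ ‖z‖ + ‖h‖ := norm_add_le _ _
  have hz3 : ‖z - h‖ ≤ ‖z‖ + ‖h‖ := norm_sub_le _ _
  have hh := norm_nonneg h
  have hx1 : ‖x₁‖ ≤ ‖z‖ + ‖h‖ + 1 := by linarith [norm_le_norm_sub_add x₁ (z + h)]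
  have hx2 : ‖x₂‖ ≤ ‖z‖ + ‖h‖ + 1 := by linarith [norm_le_norm_sub_add x₂ z]
  have hx3 : ‖x₃‖ ≤ ‖z‖ + ‖h‖ + 1 := by linarith [norm_le_norm_sub_add x₃ (z - h)]
  have hpq : ∀ p q : Euc n, ‖p‖ ≤ R → ‖q‖ ≤ R → ‖p - q‖ ≤ σ → |a p - w q| ≤ ε₂ / 16 := by
    intro p q hp hq hd
    have t1 := (haw p (by simpa using hp)).trans (min_le_right _ _)
    have t2 := hσ2 p q hp hq hd
    linarith [abs_sub_le (a p) (w p) (w q)]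
  set E : Euc n → ℝ := fun y =>
    1 * secondDiff a x₁ y + 1 * secondDiff a x₃ y + -2 * secondDiff a x₂ y with hE
  have hEG : ∀ y : Euc n, ‖y‖ ≤ A →
      E y ≤ secondDiff w (z + y) h + secondDiff w (z - y) h - 2 * M + ε₂ := by
    intro y hy
    have t1 := abs_le.1 (abs_secondDiff_sub_le hpq (h₁.trans hσ'') (y := y) (by linarith)
      (by linarith))
    have t2 := abs_le.1 (abs_secondDiff_sub_le hpq (h₂.trans hσ'') (y := y) (by linarith)
      (by linarith))
    have t3 := abs_le.1 (abs_secondDiff_sub_le hpq (h₃.trans hσ'') (y := y) (by linarith)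
      (by linarith))
    have := secondDiff_secondDiff_comm w z h y
    rw [hz] at this
    simp only [hE]
    linarith [t1.2, t2.1, t3.2]
  have hsmall := fun (y : Euc n) (hy : ‖y‖ ≤ 1 / 2) => secondDiff_le_of_penalized_isMax
    (h₁.trans hσ') (h₂.trans hσ') (h₃.trans hσ') hmax hy
  have hint : ∀ (c : ℝ) (x : Euc n),
      IntegrableOn (fun y => c * secondDiff a x y) (ball 0 r)ᶜ (K 0) :=
    fun c x => Integrable.const_mul
      ((((hK 0).integral_compl_ball_rpow hL hβ hr).1.const_mul 2).mono'
        (continuous_secondDiff haH.continuous x).aestronglyMeasurable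
        (.of_forall fun y => haH.abs_secondDiff_le hβ2 hβ1 x y)) c
  have hup : ∫ y in (ball 0 r)ᶜ, E y ∂K 0 ≤ -(ω / 2 * c₀) +
      2 * θ * (C₁ * (1 / 2) ^ (2 - 2 * s)) + ε₁ * (C₂ * (1 / 2) ^ (β - 2 * s)) +
      8 * (C₂ * A ^ (β - 2 * s)) := by
    refine integral_compl_ball_le_of_le (ω := ω / 2) (θ := θ) (ε := ε₁) (A := A) hs hβ hL
      (hK 0) hT hr
      (by linarith) (hTt.trans (compl_subset_compl.2 (ball_subset_ball
        (hrt.trans (min_le_left _ _))))) hT1 (hTK _ (hK 0)) (by positivity) hθ.le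
      hε₁.le (((hint _ _).add (hint _ _)).add (hint _ _)) (fun y hy => ?_) (fun y hy => ?_)
      (fun y hy hyA => ?_) (fun y => ?_)
    · have hy2 := hT1 hy
      rw [mem_ball_zero_iff] at hy2
      linarith [hEG y (by linarith), hcon y hy, min_le_right (ε₁ * (1 / 2) ^ β) (ω / 2)]
    · have := (hsmall y (by simpa using (mem_ball_zero_iff.1 hy).le)).2.2.2
      simp only [hE]
      linarith
    · have hy' : 1 / 2 ≤ ‖y‖ := by simpa using hy
      have := hEG y (mem_ball_zero_iff.1 hyA).le
      have q : (1 / 2 : ℝ) ^ β ≤ ‖y‖ ^ β := Real.rpow_le_rpow (by norm_num) hy' hβ.1.le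
      have := mul_le_mul_of_nonneg_left q hε₁.le
      linarith [hM (z + y), hM (z - y), min_le_left (ε₁ * (1 / 2) ^ β) (ω / 2)]
    · have t1 := abs_le.1 (haH.abs_secondDiff_le hβ2 hβ1 x₁ y)
      have t2 := abs_le.1 (haH.abs_secondDiff_le hβ2 hβ1 x₂ y)
      have t3 := abs_le.1 (haH.abs_secondDiff_le hβ2 hβ1 x₃ y)
      simp only [hE]
      linarith [t1.2, t2.1, t3.2]
  have hlow : ∀ (x : Euc n) (c q : ℝ), ‖x‖ ≤ ‖z‖ + ‖h‖ + 1 → 0 ≤ q →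
      (∀ y : Euc n, ‖y‖ ≤ 1 / 2 → c * secondDiff a x y ≤ q * ‖y‖ ^ 2) →
      -(|c| * ((2 + D * r ^ (β - 2 * s)) * (1 / m))) - q * (C₁ * r ^ (2 - 2 * s)) ≤
        ∫ y in (ball 0 r)ᶜ, c * secondDiff a x y ∂K 0 := by
    intro x c q hx hq hle
    obtain ⟨i, hi⟩ := hKa x (by rw [mem_ball_zero_iff]; linarith)
    refine le_integral_compl_ball_secondDiff hs hβ hβ1 hL (hK x) (hK 0) (hKK _ _) haH i hi hr hq
      fun y hy => hle y ?_
    exact (mem_ball_zero_iff.1 hy).le.trans (hrt.trans (min_le_right _ _))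
  have l1 := hlow x₁ 1 (2 * N) hx1 (by positivity) fun y hy => by
    rw [one_mul]; exact (hsmall y hy).1
  have l3 := hlow x₃ 1 (2 * N) hx3 (by positivity) fun y hy => by
    rw [one_mul]; exact (hsmall y hy).2.1
  have l2 := hlow x₂ (-2) (4 * N + 2 * θ) hx2 (by positivity) fun y hy => (hsmall y hy).2.2.1
  have hsum : ∫ y in (ball 0 r)ᶜ, E y ∂K 0 = _ :=
    integral_add ((hint _ _).add (hint _ _)) (hint _ _)
  rw [integral_add (hint _ _) (hint _ _)] at hsum
  rw [abs_one] at l1 l3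
  rw [abs_neg, abs_two] at l2
  rw [← hXdef] at hup
  linarith only [hup, hsum, l1, l2, l3, hmX, hrX, hθX, hεX, hAX, hX]

lemma norm_sub_sq_le_of_mem_coneAnnulus {e v y : Euc n} {R κ τ r : ℝ} (hv : v = R • e)
    (he : ‖e‖ = 1) (hR : 0 ≤ R) (hκ : 0 ≤ κ) (hr : r ≤ R * κ) (hy : y ∈ coneAnnulus e κ τ r)
    (hpos : 0 ≤ ⟪e, y⟫) : ‖v - y‖ ^ 2 ≤ R ^ 2 - R * κ * (τ * r) := by
  obtain ⟨h1, h2, h3⟩ := hy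
  rw [abs_of_nonneg hpos] at h3
  rw [hv, norm_sub_sq_real, inner_smul_left, norm_smul, he, mul_one, Real.norm_eq_abs, sq_abs]
  simp only [conj_trivial]
  have a1 := mul_le_mul_of_nonneg_left h3 hR
  have a2 : ‖y‖ * ‖y‖ ≤ ‖y‖ * (R * κ) :=
    mul_le_mul_of_nonneg_left (h2.le.trans hr) (norm_nonneg y)
  have a3 := mul_le_mul_of_nonneg_left h1 (mul_nonneg hR hκ)
  nlinarith

lemma LimitClass.secondDiff_eq_of_isMax {s β lam Lam : ℝ} (hs : s ∈ Ioo 0 1)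
    (hβ : β ∈ Ioo 0 (2 * s)) (hβ1 : β ≠ 1) (hlam : 0 < lam) (hL : 0 ≤ Lam) {w : Euc n → ℝ}
    (hw : w ∈ LimitClass s β lam Lam) {h z₀ : Euc n} {M : ℝ} (hM : ∀ x, secondDiff w x h ≤ M)
    (hz₀ : secondDiff w z₀ h = M) (x : Euc n) : secondDiff w x h = M := by
  by_contra hx
  have hg := continuous_secondDiff_left (LimitClass.continuous hw) h
  have hZ : IsClosed {x | secondDiff w x h = M} := isClosed_eq hg continuous_const
  obtain ⟨z, hz, hxz⟩ := hZ.exists_infDist_eq_dist ⟨z₀, hz₀⟩ x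
  set R := dist x z with hRdef
  have hR : 0 < R := dist_pos.2 fun h => hx (h ▸ hz)
  have hlt : ∀ p, dist x p < R → secondDiff w p h < M := fun p hp =>
    (hM p).lt_of_ne fun hpZ => (hp.trans_eq hxz.symm).not_ge (infDist_le_dist_of_mem hpZ)
  set e := R⁻¹ • (x - z) with he
  have hRe : x - z = R • e := by rw [he, smul_inv_smul₀ hR.ne']
  have he1 : ‖e‖ = 1 := by
    rw [he, norm_smul, norm_inv, Real.norm_of_nonneg hR.le, ← dist_eq_norm,
      inv_mul_cancel₀ hR.ne']
  obtain ⟨κ, hκ, τ, hτ, hcone⟩ := exists_le_measure_coneAnnulus (n := n) hs.2 hlam hL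
  set r := min (R * κ) (1 / 2) with hrdef
  have hr : 0 < r := by positivity
  have hτr : 0 < τ * r := mul_pos hτ.1 hr
  set R' := √(R ^ 2 - R * κ * (τ * r)) with hR'
  have hR'R : R' < R := by
    rw [hR', Real.sqrt_lt' hR]
    exact sub_lt_self _ (by positivity)
  obtain ⟨p, hp, hpmax⟩ := (isCompact_closedBall x R').exists_isMaxOn
    ⟨x, mem_closedBall_self (Real.sqrt_nonneg _)⟩ hg.continuousOn
  have hpM := hlt p (by rw [dist_comm]; exact (mem_closedBall.1 hp).trans_lt hR'R)
  obtain ⟨y, hy, hyM⟩ := LimitClass.exists_le_of_isMax hs hβ hβ1 hL hw hM hz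
    (measurableSet_coneAnnulus e κ τ r)
    (fun y hy => mem_ball_zero_iff.2 (hy.2.1.trans_le (min_le_right _ _))) hτr
    (fun y hy => by simpa using hy.1) (c₀ := lam / 4 * r ^ (-(2 * s))) (by positivity)
    (fun K hK => hcone K hK r hr e he1) (sub_pos.2 hpM)
  rcases le_total 0 ⟪e, y⟫ with hpos | hneg
  · have hd := norm_sub_sq_le_of_mem_coneAnnulus hRe he1 hR.le hκ.le (min_le_left _ _) hy hpos
    have : secondDiff w (z + y) h ≤ secondDiff w p h := hpmax <| by
      rw [mem_closedBall, dist_comm, dist_eq_norm, ← sub_sub]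
      exact Real.le_sqrt_of_sq_le hd
    linarith [hM (z - y)]
  · have hy' : -y ∈ coneAnnulus e κ τ r := by simpa [coneAnnulus] using hy
    have hd := norm_sub_sq_le_of_mem_coneAnnulus hRe he1 hR.le hκ.le (min_le_left _ _) hy'
      (by simpa using hneg)
    have : secondDiff w (z - y) h ≤ secondDiff w p h := hpmax <| by
      rw [mem_closedBall, dist_comm, dist_eq_norm, sub_eq_add_neg z y, ← sub_sub]
      exact Real.le_sqrt_of_sq_le hd
    linarith [hM (z + y)]

lemma Admissible.mono {s β lam Lam m m' : ℝ} (hm : 0 < m) (h : m ≤ m') {a : Euc n → ℝ}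
    (ha : Admissible s β lam Lam m' a) : Admissible s β lam Lam m a := by
  obtain ⟨hH, hT, K, hK, hKK, hKa⟩ := ha
  refine ⟨hH, hT, K, hK, fun x x' ρ hρ φ h1 h2 h3 => (hKK x x' ρ hρ φ h1 h2 h3).trans ?_,
    fun x hx => ?_⟩
  · gcongr
  · obtain ⟨h1, h2⟩ := hKa x (ball_subset_ball h hx)
    exact ⟨h1, h2.trans (by gcongr)⟩

lemma HolderUnit.taylorZero_comp_add_sub {β : ℝ} (hβ : β < 2) {a : Euc n → ℝ}
    (ha : HolderUnit β a) (σ : ℝ) (x₀ : Euc n) (l : Euc n →L[ℝ] ℝ)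
    (hl : 1 < β → l = σ • fderiv ℝ a x₀) :
    TaylorZero β fun x => σ * a (x + x₀) - (σ * a x₀ + l x) := by
  refine ⟨by simp, fun h1 => ?_⟩
  have hd : DifferentiableAt ℝ a (0 + x₀) :=
    ((holderUnit_iff_of_one_lt h1 hβ a).1 ha).1.differentiable one_ne_zero _
  have h2 := (((hasFDerivAt_comp_add_right x₀).2 hd.hasFDerivAt).const_mul σ).sub
    (l.hasFDerivAt.const_add (σ * a x₀))
  refine h2.fderiv.trans ?_
  rw [hl h1, zero_add, sub_self]

lemma HolderUnit.admissible_comp_add_sub {s β lam Lam m : ℝ} (hβ : β ∈ Ioo 0 2) (hβ1 : β ≠ 1)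
    {a : Euc n → ℝ} (ha : HolderUnit β a) {K : Euc n → Measure (Euc n)}
    (hK : ∀ x, UnifElliptic s lam Lam (K x)) (hKK : ∀ x x', KantCond s β (K x) (K x') (1 / m))
    (hKa : ∀ x ∈ ball 0 m, Integrable (secondDiff a x) (K x) ∧
      |∫ y, secondDiff a x y ∂K x| ≤ 2 / m)
    {σ : ℝ} (hσ : |σ| ≤ 1) {x₀ : Euc n} (hx₀ : ‖x₀‖ < m) {l : Euc n →L[ℝ] ℝ}
    (hl : β < 1 → l = 0) (hl' : 1 < β → l = σ • fderiv ℝ a x₀) :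
    Admissible s β lam Lam (m - ‖x₀‖) fun x => σ * a (x + x₀) - (σ * a x₀ + l x) := by
  have hm : 0 < m - ‖x₀‖ := sub_pos.2 hx₀
  have hle : m - ‖x₀‖ ≤ m := sub_le_self _ (norm_nonneg _)
  refine ⟨ha.comp_add_sub hβ hβ1 σ hσ x₀ _ l hl, ha.taylorZero_comp_add_sub hβ.2 σ x₀ l hl',
    fun x => K (x + x₀), fun x => hK _, fun x x' ρ hρ φ h1 h2 h3 =>
      (hKK _ _ ρ hρ φ h1 h2 h3).trans (by gcongr), fun x hx => ?_⟩
  have hsd : secondDiff (fun x => σ * a (x + x₀) - (σ * a x₀ + l x)) x =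
      fun y => σ * secondDiff a (x + x₀) y := funext (secondDiff_comp_add_sub a σ x₀ _ l x)
  obtain ⟨h1, h2⟩ := hKa (x + x₀) (by
    rw [mem_ball_zero_iff] at hx ⊢
    linarith [norm_add_le x x₀])
  rw [hsd]
  refine ⟨h1.const_mul σ, ?_⟩
  rw [integral_const_mul, abs_mul]
  calc |σ| * |∫ y, secondDiff a (x + x₀) y ∂K (x + x₀)| ≤ 1 * (2 / m) := by gcongr
    _ ≤ 2 / (m - ‖x₀‖) := by rw [one_mul]; gcongr

lemma Admissible.neg {s β lam Lam m : ℝ} (hβ : β ∈ Ioo 0 2) (hβ1 : β ≠ 1) (hm : 0 < m)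
    {a : Euc n → ℝ} (ha : Admissible s β lam Lam m a) :
    Admissible s β lam Lam m fun x => -a x := by
  obtain ⟨hH, hT, K, hK, hKK, hKa⟩ := ha
  simpa [hT.1] using hH.admissible_comp_add_sub hβ hβ1 hK hKK hKa (σ := -1) (x₀ := 0) (l := 0)
    (by simp) (by simpa using hm) (fun _ => rfl) fun h1 => by rw [hT.2 h1, smul_zero]

lemma Admissible.exists_translate {s β lam Lam m : ℝ} (hβ : β ∈ Ioo 0 2) (hβ1 : β ≠ 1)
    {a : Euc n → ℝ} {x₀ : Euc n} (ha : Admissible s β lam Lam (m + ‖x₀‖) a) (hm : 0 < m) :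
    ∃ b, Admissible s β lam Lam m b ∧ ∀ h, secondDiff b 0 h = secondDiff a x₀ h := by
  obtain ⟨hH, hT, K, hK, hKK, hKa⟩ := ha
  have := hH.admissible_comp_add_sub hβ hβ1 hK hKK hKa (σ := 1) (x₀ := x₀)
    (l := if β < 1 then 0 else (1 : ℝ) • fderiv ℝ a x₀) (by simp) (by linarith)
    (fun h => if_pos h) fun h => if_neg h.not_gt
  rw [add_sub_cancel_right] at this
  exact ⟨_, this, fun h => by rw [secondDiff_comp_add_sub, one_mul, zero_add]⟩

lemma exists_locallyUniform_limit {s β lam Lam : ℝ} (hβ : β ∈ Ioo 0 2) (hβ1 : β ≠ 1)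
    {S : ℕ → Set (Euc n → ℝ)} (hanti : Antitone S) (hne : ∀ k, (S k).Nonempty)
    (hS : ∀ k, ∀ a ∈ S k, Admissible s β lam Lam (k + 1) a) :
    ∃ w : Euc n → ℝ, ∀ (R : ℝ) (k : ℕ) (ε : ℝ), 0 < ε →
      ∃ a ∈ S k, ∀ x ∈ closedBall 0 R, |a x - w x| ≤ ε := by
  have hB : IsCompact (Set.pi univ fun x : Euc n => Icc (-‖x‖ ^ β) (‖x‖ ^ β)) :=
    isCompact_univ_pi fun _ => isCompact_Icc
  have hSB : S 0 ⊆ Set.pi univ fun x : Euc n => Icc (-‖x‖ ^ β) (‖x‖ ^ β) := fun a ha x _ =>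
    abs_le.1 ((hS 0 a ha).1.abs_le_rpow hβ hβ1 (hS 0 a ha).2.1 x)
  obtain ⟨w, hw⟩ := IsCompact.nonempty_iInter_of_sequence_nonempty_isCompact_isClosed
    (fun k => closure (S k)) (fun k => closure_mono (hanti k.le_succ)) (fun k => (hne k).closure)
    (hB.closure_of_subset hSB) fun k => isClosed_closure
  rw [mem_iInter] at hw
  refine ⟨w, fun R k ε hε => ?_⟩
  obtain ⟨ρ, hρ, hρε⟩ : ∃ ρ > 0, ∀ x ∈ closedBall (0 : Euc n) R, ∀ y ∈ closedBall (0 : Euc n) R,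
      dist x y < ρ → ∀ a ∈ S k, |a x - a y| ≤ ε / 3 := by
    have hc : ContinuousAt (fun d : ℝ => (1 + R) * (d + d ^ β)) 0 :=
      (continuousAt_id.add (Real.continuousAt_rpow_const _ _ (.inr hβ.1.le))).const_mul _
    obtain ⟨ρ, hρ, h⟩ := Metric.continuousAt_iff.1 hc (ε / 3) (by positivity)
    refine ⟨ρ, hρ, fun x hx y hy hxy a ha => ?_⟩
    have h1 := h (x := ‖x - y‖) (by simpa [dist_eq_norm] using hxy)
    rw [Real.zero_rpow hβ.1.ne', add_zero, mul_zero, dist_zero_right] at h1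
    exact ((hS k a ha).1.abs_sub_le hβ hβ1 (hS k a ha).2.1 (by simpa using hx)
      (by simpa using hy)).trans ((le_abs_self _).trans h1.le)
  have hwρ : ∀ x ∈ closedBall (0 : Euc n) R, ∀ y ∈ closedBall (0 : Euc n) R,
      dist x y < ρ → |w x - w y| ≤ ε / 3 := fun x hx y hy hxy => by
    have hcl : IsClosed {a : Euc n → ℝ | |a x - a y| ≤ ε / 3} :=
      isClosed_le (by fun_prop) continuous_const
    exact closure_minimal (hρε x hx y hy hxy) hcl (hw k)
  obtain ⟨t, ht, htf, htc⟩ := (isCompact_closedBall (0 : Euc n) R).finite_cover_balls hρ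
  have hO : IsOpen {a : Euc n → ℝ | ∀ c ∈ t, |a c - w c| < ε / 3} := by
    simp only [Set.ofPred_forall]
    exact htf.isOpen_biInter fun c _ => isOpen_lt (by fun_prop) continuous_const
  obtain ⟨a, haO, haS⟩ := mem_closure_iff.1 (hw k) _ hO fun c _ => by simpa using hε
  refine ⟨a, haS, fun x hx => ?_⟩
  obtain ⟨c, hc, hxc⟩ := mem_iUnion₂.1 (htc hx)
  have h1 := abs_le.1 (hρε x hx c (ht hc) hxc a haS)
  have h2 := abs_le.1 (hwρ x hx c (ht hc) hxc)
  have h3 := abs_lt.1 (haO c hc)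
  rw [abs_le]
  constructor <;> linarith

lemma mem_limitClass_of_nat {s β lam Lam : ℝ} {w : Euc n → ℝ}
    (h : ∀ (R : ℝ) (k : ℕ) (ε : ℝ), 0 < ε →
      ∃ a, Admissible s β lam Lam (k + 1) a ∧ ∀ x ∈ closedBall 0 R, |a x - w x| ≤ ε) :
    w ∈ LimitClass s β lam Lam := by
  intro R m ε hm hε
  obtain ⟨a, ha, haw⟩ := h R ⌈m⌉₊ ε hε
  exact ⟨a, ha.mono hm ((Nat.le_ceil m).trans (by linarith)), haw⟩

lemma LimitClass.neg {s β lam Lam : ℝ} (hβ : β ∈ Ioo 0 2) (hβ1 : β ≠ 1) {w : Euc n → ℝ}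
    (hw : w ∈ LimitClass s β lam Lam) : (fun x => -w x) ∈ LimitClass s β lam Lam := by
  intro R m ε hm hε
  obtain ⟨a, ha, haw⟩ := hw R m ε hm hε
  refine ⟨_, ha.neg hβ hβ1 hm, fun x hx => ?_⟩
  rw [neg_sub_neg, abs_sub_comm]
  exact haw x hx

lemma LimitClass.abs_le_rpow {s β lam Lam : ℝ} (hβ : β ∈ Ioo 0 2) (hβ1 : β ≠ 1) {w : Euc n → ℝ}
    (hw : w ∈ LimitClass s β lam Lam) (x : Euc n) : |w x| ≤ ‖x‖ ^ β := by
  refine le_of_forall_pos_le_add fun ε hε => ?_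
  obtain ⟨a, ha, haw⟩ := hw ‖x‖ 1 ε one_pos hε
  have h1 := haw x (by simp)
  have h2 := ha.1.abs_le_rpow hβ hβ1 ha.2.1 x
  have := abs_sub_abs_le_abs_sub (w x) (a x)
  rw [abs_sub_comm] at this
  linarith

lemma LimitClass.secondDiff_le {s β lam Lam : ℝ} (hβ : β ∈ Ioo 0 2) (hβ1 : β ≠ 1) {h : Euc n}
    {M : ℝ} (hM : ∀ ε > 0, ∃ m > 0, ∀ a, Admissible s β lam Lam m a → secondDiff a 0 h ≤ M + ε)
    {w : Euc n → ℝ} (hw : w ∈ LimitClass s β lam Lam) (x : Euc n) : secondDiff w x h ≤ M := by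
  refine le_of_forall_pos_le_add fun ε hε => ?_
  obtain ⟨m, hm, hmM⟩ := hM (ε / 5) (by positivity)
  obtain ⟨a, ha, haw⟩ := hw (‖x‖ + ‖h‖) (m + ‖x‖) (ε / 5) (by positivity) (by positivity)
  obtain ⟨b, hb, hba⟩ := ha.exists_translate hβ hβ1 hm
  have h1 := hmM b hb
  rw [hba] at h1
  have h2 := abs_secondDiff_sub_le (a := a) (w := w) (σ := 0) (R := ‖x‖ + ‖h‖) (x := x) (z := x)
    (y := h) (fun p q hp _ hpq => by
      obtain rfl : p = q := sub_eq_zero.1 (norm_le_zero_iff.1 hpq)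
      exact haw p (by simpa using hp)) (by simp) le_rfl le_rfl
  linarith [(abs_le.1 h2).1]

lemma LimitClass.exists_isMax {s β lam Lam : ℝ} (hβ : β ∈ Ioo 0 2) (hβ1 : β ≠ 1)
    (hne : (LimitClass s β lam Lam : Set (Euc n → ℝ)).Nonempty) (h : Euc n) :
    ∃ M, (∀ w ∈ (LimitClass s β lam Lam : Set (Euc n → ℝ)), ∀ x, secondDiff w x h ≤ M) ∧
      ∃ w ∈ (LimitClass s β lam Lam : Set (Euc n → ℝ)), secondDiff w 0 h = M := by
  obtain ⟨w₁, hw₁⟩ := hne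
  set U := {c : ℝ | ∃ m > 0, ∀ a : Euc n → ℝ, Admissible s β lam Lam m a → secondDiff a 0 h ≤ c}
  have hb : BddBelow U := by
    refine ⟨-(2 * ‖h‖ ^ β), fun c ⟨m, hm, hc⟩ => ?_⟩
    obtain ⟨a, ha, -⟩ := hw₁ 0 m 1 hm one_pos
    exact (abs_le.1 (ha.1.abs_secondDiff_le hβ hβ1 0 h)).1.trans (hc a ha)
  have hUne : U.Nonempty := ⟨2 * ‖h‖ ^ β, 1, one_pos, fun a ha =>
    (abs_le.1 (ha.1.abs_secondDiff_le hβ hβ1 0 h)).2⟩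
  have hM : ∀ ε > 0, ∃ m > 0, ∀ a : Euc n → ℝ, Admissible s β lam Lam m a →
      secondDiff a 0 h ≤ sInf U + ε := fun ε hε => by
    obtain ⟨c, ⟨m, hm, hc⟩, hcε⟩ := exists_lt_of_csInf_lt hUne (lt_add_of_pos_right (sInf U) hε)
    exact ⟨m, hm, fun a ha => (hc a ha).trans hcε.le⟩
  have hle : ∀ w ∈ (LimitClass s β lam Lam : Set (Euc n → ℝ)), ∀ x, secondDiff w x h ≤ sInf U :=
    fun w hw x => LimitClass.secondDiff_le hβ hβ1 hM hw x
  refine ⟨sInf U, hle, ?_⟩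
  set S : ℕ → Set (Euc n → ℝ) := fun k =>
    {a | Admissible s β lam Lam (k + 1) a ∧ sInf U - 1 / (k + 1) ≤ secondDiff a 0 h} with hS
  have hanti : Antitone S := fun k l hkl a ⟨ha, haU⟩ => by
    have hkl' : (k : ℝ) ≤ l := by exact_mod_cast hkl
    refine ⟨ha.mono (by positivity) (by linarith), le_trans ?_ haU⟩
    gcongr
  have hSne : ∀ k, (S k).Nonempty := fun k => by
    have : sInf U - 1 / (k + 1 : ℝ) ∉ U := fun hmem =>
      (csInf_le hb hmem).not_gt (sub_lt_self _ (by positivity))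
    by_contra hemp
    refine this ⟨k + 1, by positivity, fun a ha => ?_⟩
    by_contra hlt
    exact hemp ⟨a, ha, (not_le.1 hlt).le⟩
  obtain ⟨w, hw⟩ := exists_locallyUniform_limit hβ hβ1 hanti hSne fun k a ha => ha.1
  have hwL : w ∈ LimitClass s β lam Lam := mem_limitClass_of_nat fun R k ε hε => by
    obtain ⟨a, ha, haw⟩ := hw R k ε hε
    exact ⟨a, ha.1, haw⟩
  refine ⟨w, hwL, (hle w hwL 0).antisymm (le_of_forall_pos_le_add fun ε hε => ?_)⟩
  obtain ⟨k, hk⟩ := exists_nat_one_div_lt (show 0 < ε / 5 by positivity)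
  obtain ⟨a, ha, haw⟩ := hw ‖h‖ k (ε / 5) (by positivity)
  have h2 := abs_secondDiff_sub_le (a := a) (w := w) (σ := 0) (R := ‖h‖) (x := 0) (z := 0)
    (y := h) (fun p q hp _ hpq => by
      obtain rfl : p = q := sub_eq_zero.1 (norm_le_zero_iff.1 hpq)
      exact haw p (by simpa using hp)) (by simp) (by simp) (by simp)
  linarith [(abs_le.1 h2).2, ha.2]

lemma nonpos_of_forall_le_mul_rpow_neg {v C p : ℝ} (hp : 0 < p)
    (h : ∀ j : ℕ, 0 < j → v ≤ C * (j : ℝ) ^ (-p)) : v ≤ 0 := by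
  have ht : Filter.Tendsto (fun j : ℕ => C * (j : ℝ) ^ (-p)) Filter.atTop (𝓝 (C * 0)) :=
    ((tendsto_rpow_neg_atTop hp).comp tendsto_natCast_atTop_atTop).const_mul C
  rw [mul_zero] at ht
  exact ge_of_tendsto ht (Filter.eventually_atTop.2 ⟨1, fun j hj => h j hj⟩)

lemma apply_natCast_smul_of_secondDiff_eq {w : Euc n → ℝ} (h0 : w 0 = 0) {h : Euc n} {M : ℝ}
    (hM : ∀ x, secondDiff w x h = M) (j : ℕ) :
    w ((j : ℝ) • h) = j * w h + j * (j - 1) / 2 * M := by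
  induction j using Nat.twoStepInduction with
  | zero => simp [h0]
  | one => simp
  | more j ih1 ih2 =>
    have := hM (((j + 1 : ℕ) : ℝ) • h)
    have e1 : ((j + 1 : ℕ) : ℝ) • h + h = ((j + 2 : ℕ) : ℝ) • h := by
      push_cast; module
    have e2 : ((j + 1 : ℕ) : ℝ) • h - h = (j : ℝ) • h := by
      push_cast; module
    rw [secondDiff, e1, e2, ih1, ih2] at this
    push_cast at this ⊢
    linarith

lemma secondDiff_neg_right (w : Euc n → ℝ) (x h : Euc n) :
    secondDiff w x (-h) = secondDiff w x h := by
  simp only [secondDiff, sub_neg_eq_add, ← sub_eq_add_neg]; ring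

lemma eq_zero_of_secondDiff_eq {β : ℝ} (hβ : β < 2) {w : Euc n → ℝ}
    (hw : ∀ x, |w x| ≤ ‖x‖ ^ β) (h0 : w 0 = 0) {h : Euc n} {M : ℝ}
    (hM : ∀ x, secondDiff w x h = M) : M = 0 := by
  refine abs_nonpos_iff.1 (nonpos_of_forall_le_mul_rpow_neg (C := 2 * ‖h‖ ^ β) (sub_pos.2 hβ)
    fun j hj => ?_)
  have hj' : (0 : ℝ) < j := Nat.cast_pos.2 hj
  have h1 := apply_natCast_smul_of_secondDiff_eq h0 hM j
  have h2 := apply_natCast_smul_of_secondDiff_eq h0 (h := -h)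
    (fun x => (secondDiff_neg_right w x h).trans (hM x)) j
  have h3 := hM 0
  rw [secondDiff, zero_add, zero_sub, h0] at h3
  have b1 := hw ((j : ℝ) • h)
  have b2 := hw ((j : ℝ) • -h)
  rw [norm_smul, norm_neg, Real.norm_of_nonneg hj'.le, Real.mul_rpow hj'.le (norm_nonneg h)] at b2
  rw [norm_smul, Real.norm_of_nonneg hj'.le, Real.mul_rpow hj'.le (norm_nonneg h)] at b1
  have hsum : (j : ℝ) ^ 2 * M = w ((j : ℝ) • h) + w ((j : ℝ) • -h) := by
    rw [h1, h2]
    linear_combination (-(j : ℝ)) * h3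
  have h5 : (j : ℝ) ^ 2 * |M| ≤ 2 * ‖h‖ ^ β * (j : ℝ) ^ β := by
    rw [← abs_of_pos (pow_pos hj' 2), ← abs_mul, hsum]
    linarith [abs_add_le (w ((j : ℝ) • h)) (w ((j : ℝ) • -h))]
  rw [neg_sub, Real.rpow_sub hj', Real.rpow_two, ← mul_div_assoc, le_div_iff₀ (by positivity),
    mul_comm]
  exact h5

lemma eq_zero_of_apply_natCast_smul {β : ℝ} (hβ1 : β ≠ 1) {w : Euc n → ℝ}
    (hw : ∀ x, |w x| ≤ ‖x‖ ^ β) (hadd : ∀ (j : ℕ) x, w ((j : ℝ) • x) = j * w x) (x : Euc n) :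
    w x = 0 := by
  refine abs_nonpos_iff.1 ?_
  rcases hβ1.lt_or_gt with h1 | h1
  · refine nonpos_of_forall_le_mul_rpow_neg (C := ‖x‖ ^ β) (sub_pos.2 h1) fun j hj => ?_
    have hj' : (0 : ℝ) < j := Nat.cast_pos.2 hj
    have b := hw ((j : ℝ) • x)
    rw [hadd, abs_mul, Nat.abs_cast, norm_smul, Real.norm_of_nonneg hj'.le,
      Real.mul_rpow hj'.le (norm_nonneg x)] at b
    rw [neg_sub, Real.rpow_sub hj', Real.rpow_one, ← mul_div_assoc, le_div_iff₀ hj']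
    linarith
  · refine nonpos_of_forall_le_mul_rpow_neg (C := ‖x‖ ^ β) (sub_pos.2 h1) fun j hj => ?_
    have hj' : (0 : ℝ) < j := Nat.cast_pos.2 hj
    have b := hw ((j : ℝ)⁻¹ • x)
    have e := hadd j ((j : ℝ)⁻¹ • x)
    rw [smul_inv_smul₀ hj'.ne'] at e
    rw [norm_smul, norm_inv, Real.norm_of_nonneg hj'.le,
      Real.mul_rpow (by positivity) (norm_nonneg x), Real.inv_rpow hj'.le] at b
    rw [e, abs_mul, Nat.abs_cast, neg_sub, Real.rpow_sub hj', Real.rpow_one, div_eq_mul_inv]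
    calc _ ≤ (j : ℝ) * (((j : ℝ) ^ β)⁻¹ * ‖x‖ ^ β) := by gcongr
      _ = _ := by ring

lemma LimitClass.eq_zero {s β lam Lam : ℝ} (hs : s ∈ Ioo 0 1) (hβ : β ∈ Ioo 0 (2 * s))
    (hβ1 : β ≠ 1) (hlam : 0 < lam) (hL : 0 ≤ Lam) {w : Euc n → ℝ}
    (hw : w ∈ LimitClass s β lam Lam) (x : Euc n) : w x = 0 := by
  have hβ2 : β ∈ Ioo 0 2 := ⟨hβ.1, by linarith [hβ.2, hs.2]⟩
  have hzero : ∀ v ∈ (LimitClass s β lam Lam : Set (Euc n → ℝ)), v 0 = 0 := fun v hv => by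
    simpa [Real.zero_rpow hβ.1.ne'] using LimitClass.abs_le_rpow hβ2 hβ1 hv 0
  have hle : ∀ v ∈ (LimitClass s β lam Lam : Set (Euc n → ℝ)), ∀ y h, secondDiff v y h ≤ 0 := by
    intro v hv y h
    obtain ⟨M, hM, v₀, hv₀, hv₀M⟩ := LimitClass.exists_isMax hβ2 hβ1 ⟨v, hv⟩ h
    have hM0 := eq_zero_of_secondDiff_eq hβ2.2 (LimitClass.abs_le_rpow hβ2 hβ1 hv₀)
      (hzero v₀ hv₀) (LimitClass.secondDiff_eq_of_isMax hs hβ hβ1 hlam hL hv₀ (hM v₀ hv₀) hv₀M)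
    exact (hM v hv y).trans_eq hM0
  refine eq_zero_of_apply_natCast_smul hβ1 (LimitClass.abs_le_rpow hβ2 hβ1 hw) (fun j y => ?_) x
  have hsd : ∀ z, secondDiff w z y = 0 := fun z => by
    have h1 := hle w hw z y
    have h2 := hle _ (LimitClass.neg hβ2 hβ1 hw) z y
    simp only [secondDiff] at h1 h2 ⊢
    linarith
  simpa using apply_natCast_smul_of_secondDiff_eq (hzero w hw) hsd j

lemma exists_admissible_abs_le {s β lam Lam : ℝ} (hs : s ∈ Ioo 0 1) (hβ : β ∈ Ioo 0 (2 * s))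
    (hβ1 : β ≠ 1) (hlam : 0 < lam) (hL : 0 ≤ Lam) (R : ℝ) {ε : ℝ} (hε : 0 < ε) :
    ∃ m > 0, ∀ a : Euc n → ℝ, Admissible s β lam Lam m a → ∀ x ∈ ball (0 : Euc n) R, |a x| ≤ ε := by
  by_contra! hcon
  have hβ2 : β ∈ Ioo 0 2 := ⟨hβ.1, by linarith [hβ.2, hs.2]⟩
  set S : ℕ → Set (Euc n → ℝ) := fun k =>
    {a | Admissible s β lam Lam (k + 1) a ∧ ∃ x ∈ ball (0 : Euc n) R, ε < |a x|} with hS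
  have hanti : Antitone S := fun k l hkl a ⟨ha, hax⟩ =>
    ⟨ha.mono (by positivity) (by simpa using hkl), hax⟩
  obtain ⟨w, hw⟩ := exists_locallyUniform_limit hβ2 hβ1 hanti
    (fun k => hcon (k + 1) (by positivity)) fun k a ha => ha.1
  have hwL : w ∈ LimitClass s β lam Lam := mem_limitClass_of_nat fun R k ε hε => by
    obtain ⟨a, ha, haw⟩ := hw R k ε hε
    exact ⟨a, ha.1, haw⟩
  obtain ⟨a, ⟨-, x, hx, hax⟩, haw⟩ := hw R 0 ε hε
  have := haw x (ball_subset_closedBall hx)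
  rw [LimitClass.eq_zero hs hβ hβ1 hlam hL hwL, sub_zero] at this
  exact hax.not_ge this

lemma supNorm_le_ofReal {Ω : Set (Euc n)} {v : Euc n → ℝ} {c : ℝ} (h : ∀ x ∈ Ω, |v x| ≤ c) :
    supNorm Ω v ≤ ENNReal.ofReal c :=
  iSup_le fun x => ENNReal.ofReal_le_ofReal (h x x.2)

lemma abs_le_of_supNorm_le {Ω : Set (Euc n)} {v : Euc n → ℝ} {c : ℝ} (hc : 0 ≤ c)
    (h : supNorm Ω v ≤ ENNReal.ofReal c) {x : Euc n} (hx : x ∈ Ω) : |v x| ≤ c :=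
  (ENNReal.ofReal_le_ofReal_iff hc).1
    ((le_iSup (fun x : Ω => ENNReal.ofReal |v x|) ⟨x, hx⟩).trans h)

lemma SolvesPtwise.integrable_secondDiff {K : Euc n → Measure (Euc n)} {u f : Euc n → ℝ}
    {Ω : Set (Euc n)} (h : SolvesPtwise K u f Ω) {x : Euc n} (hx : x ∈ Ω) :
    Integrable (secondDiff u x) (K x) ∧ ∫ y, secondDiff u x y ∂K x = -2 * f x := by
  obtain ⟨h1, h2⟩ := h x hx
  have e : secondDiff u x = fun y => -(2 * u x - u (x + y) - u (x - y)) := by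
    funext y; simp only [secondDiff]; ring
  rw [e]
  refine ⟨h1.neg, ?_⟩
  rw [integral_neg, ← h2, Lop]
  ring

/-- **Quantitative Liouville-type estimate in non-divergence form** (Proposition 6.2).
If the uniformly elliptic symmetric Lévy kernels `K_x` have Kantorovich-oscillation at most
`η ≤ δ`, and `u ∈ C^{2s+ε'}(ℝⁿ) ∩ L^∞(ℝⁿ)` with `[u]_{C^β(ℝⁿ)} ≤ 1` solves `L(u,x) = f`
pointwise in `B_{1/δ}` with `‖f‖_{L^∞(B_{1/δ})} ≤ δ`, then `‖u − ℓ‖_{C^{⌊β⌋}(B₁)} ≤ ε₀`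
whenever `δ < δ₀(ε₀)`, `ℓ` being the `⌊β⌋`-th order Taylor expansion of `u` at `0`. -/
theorem stmt12 (n : ℕ) (s β lam Lam : ℝ)
    (hs : s ∈ Set.Ioo (0 : ℝ) 1) (hβ : β ∈ Set.Ioo 0 (2 * s)) (hβ1 : β ≠ 1)
    (hlam : 0 < lam) (hlamLam : lam ≤ Lam) :
    ∀ ε₀ > (0 : ℝ), ∃ δ₀ > (0 : ℝ), ∀ δ : ℝ, 0 < δ → δ < δ₀ →
      ∀ (K : Euc n → Measure (Euc n)) (η : ℝ) (u f : Euc n → ℝ) (ε' : ℝ),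
        (∀ x, IsLevyMeasure (K x)) →
        (∀ x, UnifElliptic s lam Lam (K x)) →
        η ≤ δ →
        (∀ x x' : Euc n, KantCond s β (K x) (K x') η) →
        0 < ε' →
        HolderMem (2 * s + ε') Set.univ u →
        supNorm Set.univ u ≠ ⊤ →
        hSemi β Set.univ u ≤ 1 →
        supNorm (ball 0 (1 / δ)) f ≤ ENNReal.ofReal δ →
        SolvesPtwise K u f (ball 0 (1 / δ)) →
        ((β < 1 → supNorm (ball 0 1) (fun x => u x - u 0) ≤ ENNReal.ofReal ε₀) ∧
          (1 < β →
            c1Norm (ball 0 1) (fun x => u x - (u 0 + fderiv ℝ u 0 x)) ≤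
              ENNReal.ofReal ε₀)) := by
  intro ε₀ hε₀
  have hβ2 : β ∈ Ioo 0 2 := ⟨hβ.1, by linarith [hβ.2, hs.2]⟩
  obtain ⟨t, ht, ht1, htε⟩ := exists_mul_rpow_le zero_le_one (abs_pos.2 (sub_ne_zero.2 hβ1))
    (show 0 < ε₀ / 4 by positivity) one_pos
  rw [one_mul] at htε
  obtain ⟨m, hm, hsmall⟩ := exists_admissible_abs_le (n := n) hs hβ hβ1 hlam
    (hlam.le.trans hlamLam) 2 (show 0 < ε₀ * t / 8 by positivity)
  refine ⟨1 / m, by positivity, fun δ hδ hδm K η u f ε' _ hK hη hKK hε' hu _ huβ hf hsol => ?_⟩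
  have huH : HolderUnit β u := ⟨(contDiffOn_univ.1 hu.1).of_le
    (by exact_mod_cast hDeg_mono (by linarith [hβ.2])), huβ⟩
  have hadm : ∀ l : Euc n →L[ℝ] ℝ, (β < 1 → l = 0) → (1 < β → l = fderiv ℝ u 0) →
      Admissible s β lam Lam m fun x => u x - (u 0 + l x) := fun l hl hl' => by
    have := huH.admissible_comp_add_sub hβ2 hβ1 hK (m := 1 / δ) (σ := 1) (x₀ := 0)
      (fun x x' ρ hρ φ h1 h2 h3 => (hKK x x' ρ hρ φ h1 h2 h3).trans (by
        rw [one_div_one_div]; gcongr)) (fun x hx => ?_) (by simp) (by simpa using hδ) hl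
      fun h => by rw [hl' h, one_smul]
    · refine Admissible.mono hm ((le_one_div hm hδ).2 hδm.le) ?_
      simpa using this
    · obtain ⟨h1, h2⟩ := hsol.integrable_secondDiff hx
      refine ⟨h1, ?_⟩
      rw [h2, abs_mul, abs_neg, abs_two, div_div_eq_mul_div, div_one]
      exact mul_le_mul_of_nonneg_left (abs_le_of_supNorm_le hδ.le hf hx) zero_le_two
  have hball : ball (0 : Euc n) 1 ⊆ ball 0 2 := ball_subset_ball one_le_two
  have hε₀t : ε₀ * t / 8 ≤ ε₀ / 2 := by nlinarith
  refine ⟨fun h1 => supNorm_le_ofReal fun x hx => ?_, fun h1 => ?_⟩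
  · have := hsmall _ (hadm 0 (fun _ => rfl) fun h => absurd h h1.not_gt) x (hball hx)
    rw [zero_apply, add_zero] at this
    linarith
  · have ha := hadm (fderiv ℝ u 0) (fun h => absurd h h1.not_gt) fun _ => rfl
    rw [abs_of_pos (sub_pos.2 h1)] at htε
    rw [c1Norm, ← add_halves ε₀, ENNReal.ofReal_add (by positivity) (by positivity)]
    refine add_le_add (supNorm_le_ofReal fun x hx => (hsmall _ ha x (hball hx)).trans hε₀t)
      (iSup_le fun x => ENNReal.ofReal_le_ofReal ?_)
    refine (ha.1.norm_fderiv_le h1 hβ2.2 ht ht1 (hsmall _ ha) x.2).trans ?_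
    have : 2 * (ε₀ * t / 8) / t = ε₀ / 4 := by field_simp; norm_num
    linarith

end
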